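/- arXiv:2305.14170 — 2 statements merged into one kernel-verified Lean document; each statement's English description precedes it below -/
import Mathlib

section
/- For every integer m ≥ 1, the generating function S_{m,2}(x) = Σ_{n≥0} s_{m,2}(n) xⁿ of m-regular 2-contact (linear) stacks satisfies, as formal power series over ℤ, the polynomial equation Σ_{k=0}^{5} c_{m,2,k}(x)·S_{m,2}(x)^k = 0, where c_{m,2,5}(x) = 4x⁵(x−1)⁴; c_{m,2,4}(x) = −11x^{m+7} + 4x⁸ + 33x^{m+6} − x⁷ − 33x^{m+5} − 25x⁶ + 11x^{m+4} + 41x⁵ − 23x⁴ + 4x³; c_{m,2,3}(x) = 11x^{2m+5} − 8x^{m+6} − 22x^{2m+4} − 6x^{m+5} + 11x^{2m+3} + 8x⁶ + 44x^{m+4} − 5x⁵ − 38x^{m+3} − 22x⁴ + 8x^{m+2} + 27x³ − 8x²; c_{m,2,2}(x) = −5x^{3m+3} + 6x^{2m+4} + 5x^{3m+2} + 3x^{m+5} + 8x^{2m+3} − 21x^{m+4} − 19x^{2m+2} − 3x⁵ + 8x^{m+3} + 5x^{2m+1} + 15x⁴ + 20x^{m+2} − 11x³ − 10x^{m+1} −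 6x² + 5x; c_{m,2,1}(x) = x^{4m+1} − 2x^{3m+2} − 3x^{2m+3} − 3x^{3m+1} + 12x^{2m+2} + x^{3m} + 6x^{m+3} − 18x^{m+2} − 3x^{2m} − 3x³ + 5x^{m+1} + 8x² + 3x^m − 3x − 1; c_{m,2,0}(x) = x^{3m+1} − x^{3m} − 3x^{2m+1} + 3x^{2m} + 3x^{m+1} − 3x^m − x + 1. -/
/-- A step of a lattice path: up `(1,1)`, down `(1,-1)`, or horizontal `(1,0)`. -/
inductive DStep : Type
  | U : DStep
  | D : DStep
  | L : DStep
  deriving DecidableEq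

/-- The vertical displacement of a step. -/
def DStep.val : DStep → ℤ
  | .U => 1
  | .D => -1
  | .L => 0

/-- Total vertical displacement of a word of steps. -/
def stepSum (w : List DStep) : ℤ := (w.map DStep.val).sum

/-- A word of the form `D^a L^b U^c` with `a + b + c = d`. -/
def IsPieceWord (d : ℕ) (p : List DStep) : Prop :=
  ∃ a b c : ℕ, a + b + c = d ∧
    p = List.replicate a DStep.D ++ List.replicate b DStep.L ++ List.replicate c DStep.U

/-- `M` is a DLU path of length `d*n` from `(0,s)` to `(d*n,t)`:
each consecutive block (piece) of `d` steps has the form `D^a L^b U^c`,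
the path starts at height `s`, ends at height `t`, and never passes below the x-axis. -/
def IsDLUPath (d n s t : ℕ) (M : List DStep) : Prop :=
  M.length = d * n ∧
  (∀ i < n, IsPieceWord d ((M.drop (d * i)).take d)) ∧
  (s : ℤ) + stepSum M = (t : ℤ) ∧
  ∀ k ≤ M.length, 0 ≤ (s : ℤ) + stepSum (M.take k)

/-- The completed path `M̂ = L^{d-s} U^s M D^t L^{d-t}`. -/
def hatPath (d s t : ℕ) (M : List DStep) : List DStep :=
  List.replicate (d - s) DStep.L ++ List.replicate s DStep.U ++ M ++
    List.replicate t DStep.D ++ List.replicate (d - t) DStep.L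

/-- `w` contains a contiguous subpath `U P D` with `P ∈ {∅, L^d, L^{2d}, …, L^{(m-2)d}}`. -/
def HasShortUD (m d : ℕ) (w : List DStep) : Prop :=
  ∃ k : ℕ, k + 2 ≤ m ∧
    ([DStep.U] ++ List.replicate (k * d) DStep.L ++ [DStep.D]) <:+: w

/-- `w` is `m`-regular: it contains no subpath `U P D` with
`P ∈ {∅, L^d, L^{2d}, …, L^{(m-2)d}}`. -/
def RegularWord (m d : ℕ) (w : List DStep) : Prop := ¬ HasShortUD m d w

/-- `w` has pattern `Λ`: it contains a contiguous subpath `U U P D D` in which the two `U`'s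
lie in a common piece (block of `d` steps), the two `D`'s lie in a common piece, and `P`
starts and ends at the same height `h` and never passes below height `h`. -/
def HasLambda (d : ℕ) (w : List DStep) : Prop :=
  ∃ pre P suf : List DStep,
    w = pre ++ [DStep.U, DStep.U] ++ P ++ [DStep.D, DStep.D] ++ suf ∧
    (pre.length + 1) % d ≠ 0 ∧
    (pre.length + P.length + 3) % d ≠ 0 ∧
    stepSum P = 0 ∧
    (∀ k ≤ P.length, 0 ≤ stepSum (P.take k))

/-- An `m`-regular `Λ`-avoiding DLU path of length `d*n` from `(0,s)` to `(d*n,t)`: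
the regularity and `Λ`-avoidance conditions are imposed on the completed path `M̂`. -/
def IsGoodPath (m d n s t : ℕ) (M : List DStep) : Prop :=
  IsDLUPath d n s t M ∧ RegularWord m d (hatPath d s t M) ∧ ¬ HasLambda d (hatPath d s t M)

/-- A prime path: an `m`-regular `Λ`-avoiding DLU path which never touches the x-axis. -/
def IsPrimePath (m d n s t : ℕ) (M : List DStep) : Prop :=
  IsGoodPath m d n s t M ∧ ∀ k ≤ M.length, 0 < (s : ℤ) + stepSum (M.take k)

/-- `g^{⟨s,t⟩}_{m,d}(dn)`: the number of `m`-regular `Λ`-avoiding DLU paths of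
length `d*n` from `(0,s)` to `(d*n,t)`. -/
noncomputable def gCount (m d n s t : ℕ) : ℕ := {M : List DStep | IsGoodPath m d n s t M}.ncard

/-- `a^{⟨s,t⟩}_{m,d}(dn)`: the number of prime `m`-regular `Λ`-avoiding DLU paths of
length `d*n` from `(0,s)` to `(d*n,t)`. -/
noncomputable def aCount (m d n s t : ℕ) : ℕ := {M : List DStep | IsPrimePath m d n s t M}.ncard

/-- The generating function `G^{⟨s,t⟩}_{m,d}(x) = Σ_{n≥0} g^{⟨s,t⟩}_{m,d}(dn) x^{dn}`. -/
noncomputable def Gps (m d s t : ℕ) : PowerSeries ℤ :=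
  PowerSeries.mk fun N => if d ∣ N then (gCount m d (N / d) s t : ℤ) else 0

/-- The generating function `A^{⟨s,t⟩}_{m,d}(x) = Σ_{n≥0} a^{⟨s,t⟩}_{m,d}(dn) x^{dn}`. -/
noncomputable def Aps (m d s t : ℕ) : PowerSeries ℤ :=
  PowerSeries.mk fun N => if d ∣ N then (aCount m d (N / d) s t : ℤ) else 0

/-- `C_{m,d}(x) = (x^{d(m-1)} - 1)/(x^d - 1) = Σ_{k=0}^{m-2} x^{dk}`. -/
noncomputable def Cps (m d : ℕ) : PowerSeries ℤ :=
  ∑ k ∈ Finset.range (m - 1), (PowerSeries.X : PowerSeries ℤ) ^ (d * k)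

/-- `S` is a `d`-contact stack on `[n]`: a set of arcs `(i,j)` with `1 ≤ i < j ≤ n`,
noncrossing, in which every vertex lies in at most `d` arcs. -/
def IsContactStack (d n : ℕ) (S : Finset (ℕ × ℕ)) : Prop :=
  (∀ p ∈ S, 1 ≤ p.1 ∧ p.1 < p.2 ∧ p.2 ≤ n) ∧
  (∀ p ∈ S, ∀ q ∈ S, ¬ (p.1 < q.1 ∧ q.1 < p.2 ∧ p.2 < q.2)) ∧
  (∀ v : ℕ, (S.filter fun p => p.1 = v ∨ p.2 = v).card ≤ d)

/-- Every arc of `S` has length at least `m`. -/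
def ArcsRegular (m : ℕ) (S : Finset (ℕ × ℕ)) : Prop := ∀ p ∈ S, m ≤ p.2 - p.1

/-- `S` is an `m`-regular `d`-contact stack on `[n]`. -/
def IsStack (m d n : ℕ) (S : Finset (ℕ × ℕ)) : Prop :=
  IsContactStack d n S ∧ ArcsRegular m S

/-- The left degree of vertex `v`: the number of arcs ending at `v`. -/
def ldeg (S : Finset (ℕ × ℕ)) (v : ℕ) : ℕ := (S.filter fun p => p.2 = v).card

/-- The right degree of vertex `v`: the number of arcs starting at `v`. -/
def rdeg (S : Finset (ℕ × ℕ)) (v : ℕ) : ℕ := (S.filter fun p => p.1 = v).card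

/-- The map `η`, sending a stack `S` on `[n]` to the word `P_1 P_2 ⋯ P_n` where
`P_v = D^{ldeg v} L^{d - ldeg v - rdeg v} U^{rdeg v}`. -/
def eta (d n : ℕ) (S : Finset (ℕ × ℕ)) : List DStep :=
  (List.range n).flatMap fun i =>
    List.replicate (ldeg S (i + 1)) DStep.D ++
      List.replicate (d - ldeg S (i + 1) - rdeg S (i + 1)) DStep.L ++
      List.replicate (rdeg S (i + 1)) DStep.U

/-- `s_{m,d}(n)`: the number of `m`-regular `d`-contact stacks on `[n]`. -/
noncomputable def sCount (m d n : ℕ) : ℕ := {S : Finset (ℕ × ℕ) | IsStack m d n S}.ncard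

/-- The generating function `S_{m,d}(x) = Σ_{n≥0} s_{m,d}(n) xⁿ`. -/
noncomputable def Sps (m d : ℕ) : PowerSeries ℤ := PowerSeries.mk fun n => (sCount m d n : ℤ)

/-- The coefficients `c_{m,2,k}(x)` of the algebraic equation satisfied by `S_{m,2}(x)`. -/
noncomputable def cm2 (m : ℕ) : ℕ → PowerSeries ℤ
  | 5 => 4 * X ^ 5 * (X - 1) ^ 4
  | 4 => -11 * X ^ (m + 7) + 4 * X ^ 8 + 33 * X ^ (m + 6) - X ^ 7 - 33 * X ^ (m + 5) -
      25 * X ^ 6 + 11 * X ^ (m + 4) + 41 * X ^ 5 - 23 * X ^ 4 + 4 * X ^ 3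
  | 3 => 11 * X ^ (2 * m + 5) - 8 * X ^ (m + 6) - 22 * X ^ (2 * m + 4) - 6 * X ^ (m + 5) +
      11 * X ^ (2 * m + 3) + 8 * X ^ 6 + 44 * X ^ (m + 4) - 5 * X ^ 5 - 38 * X ^ (m + 3) -
      22 * X ^ 4 + 8 * X ^ (m + 2) + 27 * X ^ 3 - 8 * X ^ 2
  | 2 => -5 * X ^ (3 * m + 3) + 6 * X ^ (2 * m + 4) + 5 * X ^ (3 * m + 2) + 3 * X ^ (m + 5) +
      8 * X ^ (2 * m + 3) - 21 * X ^ (m + 4) - 19 * X ^ (2 * m + 2) - 3 * X ^ 5 +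
      8 * X ^ (m + 3) + 5 * X ^ (2 * m + 1) + 15 * X ^ 4 + 20 * X ^ (m + 2) - 11 * X ^ 3 -
      10 * X ^ (m + 1) - 6 * X ^ 2 + 5 * X
  | 1 => X ^ (4 * m + 1) - 2 * X ^ (3 * m + 2) - 3 * X ^ (2 * m + 3) - 3 * X ^ (3 * m + 1) +
      12 * X ^ (2 * m + 2) + X ^ (3 * m) + 6 * X ^ (m + 3) - 18 * X ^ (m + 2) - 3 * X ^ (2 * m) -
      3 * X ^ 3 + 5 * X ^ (m + 1) + 8 * X ^ 2 + 3 * X ^ m - 3 * X - 1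
  | 0 => X ^ (3 * m + 1) - X ^ (3 * m) - 3 * X ^ (2 * m + 1) + 3 * X ^ (2 * m) +
      3 * X ^ (m + 1) - 3 * X ^ m - X + 1
  | _ => 0
where X : PowerSeries ℤ := PowerSeries.X


/-- Degree of a vertex. -/
def vdeg (S : Finset (ℕ × ℕ)) (v : ℕ) : ℕ := (S.filter fun p => p.1 = v ∨ p.2 = v).card

/-- Stacks supported on the interval `[l, r]`. -/
def GoodOn (m l r : ℕ) (S : Finset (ℕ × ℕ)) : Prop :=
  (∀ p ∈ S, l ≤ p.1 ∧ p.1 + m ≤ p.2 ∧ p.2 ≤ r ∧ p.1 < p.2) ∧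
  (∀ p ∈ S, ∀ q ∈ S, ¬ (p.1 < q.1 ∧ q.1 < p.2 ∧ p.2 < q.2)) ∧
  (∀ v : ℕ, vdeg S v ≤ 2)

open Classical in
/-- Stacks on `[l, r]` with bounded degrees at the two end points. -/
noncomputable def TN (m l r a b : ℕ) : Finset (Finset (ℕ × ℕ)) :=
  (Finset.Icc l r ×ˢ Finset.Icc l r).powerset.filter
    fun S => GoodOn m l r S ∧ vdeg S l ≤ a ∧ vdeg S r ≤ b

/-- The members of `TN` which do not contain the arc `(l, r)`. -/
noncomputable def TF (m l r a b : ℕ) : Finset (Finset (ℕ × ℕ)) :=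
  (TN m l r a b).filter fun S => (l, r) ∉ S

lemma mem_TN {m l r a b : ℕ} {S : Finset (ℕ × ℕ)} :
    S ∈ TN m l r a b ↔ GoodOn m l r S ∧ vdeg S l ≤ a ∧ vdeg S r ≤ b := by
  classical
  unfold TN
  rw [Finset.mem_filter, Finset.mem_powerset, and_iff_right_iff_imp]
  rintro ⟨⟨h, -, -⟩, -⟩ p hp
  have := h p hp
  simp only [Finset.mem_product, Finset.mem_Icc]
  omega

lemma mem_TF {m l r a b : ℕ} {S : Finset (ℕ × ℕ)} :
    S ∈ TF m l r a b ↔ (GoodOn m l r S ∧ vdeg S l ≤ a ∧ vdeg S r ≤ b) ∧ (l, r) ∉ S := by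
  unfold TF
  rw [Finset.mem_filter, mem_TN]

lemma vdeg_eq_zero {S : Finset (ℕ × ℕ)} {v : ℕ} :
    vdeg S v = 0 ↔ ∀ p ∈ S, p.1 ≠ v ∧ p.2 ≠ v := by
  unfold vdeg
  rw [Finset.card_eq_zero, Finset.filter_eq_empty_iff]
  simp only [not_or, ne_eq]

lemma vdeg_mono {S T : Finset (ℕ × ℕ)} (h : S ⊆ T) (v : ℕ) : vdeg S v ≤ vdeg T v :=
  Finset.card_le_card (Finset.filter_subset_filter _ h)

lemma vdeg_insert {S : Finset (ℕ × ℕ)} {p : ℕ × ℕ} (h : p ∉ S) (v : ℕ) :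
    vdeg (insert p S) v = vdeg S v + if p.1 = v ∨ p.2 = v then 1 else 0 := by
  unfold vdeg
  rw [Finset.filter_insert]
  split_ifs
  · rw [Finset.card_insert_of_notMem]
    simp [h]
  · rfl

lemma vdeg_union {S T : Finset (ℕ × ℕ)} (h : Disjoint S T) (v : ℕ) :
    vdeg (S ∪ T) v = vdeg S v + vdeg T v := by
  unfold vdeg
  rw [Finset.filter_union, Finset.card_union_of_disjoint]
  exact Finset.disjoint_filter_filter h

lemma TN_zero_left (m l r b : ℕ) : TN m l r 0 b = TN m (l + 1) r 2 b := by
  ext S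
  simp only [mem_TN, Nat.le_zero, vdeg_eq_zero]
  constructor
  · rintro ⟨⟨h1, h2, h3⟩, h4, h5⟩
    refine ⟨⟨fun p hp => ?_, h2, h3⟩, h3 _, h5⟩
    have := h1 p hp
    have := h4 p hp
    omega
  · rintro ⟨⟨h1, h2, h3⟩, h4, h5⟩
    refine ⟨⟨fun p hp => ?_, h2, h3⟩, fun p hp => ?_, h5⟩
    · have := h1 p hp
      omega
    · have := h1 p hp
      omega

lemma TN_zero_right (m l r a : ℕ) : TN m l (r + 1) a 0 = TN m l r a 2 := by
  ext S
  simp only [mem_TN, Nat.le_zero, vdeg_eq_zero]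
  constructor
  · rintro ⟨⟨h1, h2, h3⟩, h4, h5⟩
    refine ⟨⟨fun p hp => ?_, h2, h3⟩, h4, h3 _⟩
    have := h1 p hp
    have := h5 p hp
    omega
  · rintro ⟨⟨h1, h2, h3⟩, h4, h5⟩
    refine ⟨⟨fun p hp => ?_, h2, h3⟩, h4, fun p hp => ?_⟩
    · have := h1 p hp
      omega
    · have := h1 p hp
      omega

lemma TF_zero_left (m l r b : ℕ) : TF m l r 0 b = TN m l r 0 b := by
  unfold TF
  refine Finset.filter_true_of_mem fun S hS h => ?_
  have := (mem_TN.1 hS).2.1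
  rw [Nat.le_zero, vdeg_eq_zero] at this
  exact (this _ h).1 rfl

lemma TF_zero_right (m l r a : ℕ) : TF m l r a 0 = TN m l r a 0 := by
  unfold TF
  refine Finset.filter_true_of_mem fun S hS h => ?_
  have := (mem_TN.1 hS).2.2
  rw [Nat.le_zero, vdeg_eq_zero] at this
  exact (this _ h).2 rfl

/-- Short intervals carry only the empty stack. -/
lemma card_TN_short {m l r a b : ℕ} (h : r < l + m) : (TN m l r a b).card = 1 := by
  rw [Finset.card_eq_one]
  refine ⟨∅, ?_⟩
  ext S
  rw [mem_TN, Finset.mem_singleton]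
  constructor
  · rintro ⟨⟨h1, -, -⟩, -, -⟩
    rw [Finset.eq_empty_iff_forall_notMem]
    intro p hp
    have := h1 p hp
    omega
  · rintro rfl
    simp [GoodOn, vdeg]

lemma vdeg_image {S : Finset (ℕ × ℕ)} {f : ℕ × ℕ → ℕ × ℕ} {v w : ℕ}
    (hf : Set.InjOn f S)
    (h : ∀ p ∈ S, ((f p).1 = w ∨ (f p).2 = w) ↔ (p.1 = v ∨ p.2 = v)) :
    vdeg (S.image f) w = vdeg S v := by
  unfold vdeg
  rw [Finset.filter_image, Finset.card_image_of_injOn]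
  · congr 1
    exact Finset.filter_congr h
  · exact hf.mono (by intro p hp; exact (Finset.mem_filter.1 hp).1)

/-- Generic transport of stacks along an arc map (a shift). -/
lemma shift_mem {m l r a b c : ℕ} {S : Finset (ℕ × ℕ)} (hS : S ∈ TN m l r a b) :
    S.image (fun p => (p.1 + c, p.2 + c)) ∈ TN m (l + c) (r + c) a b := by
  have inj : Set.InjOn (fun p : ℕ × ℕ => (p.1 + c, p.2 + c)) S := by
    rintro ⟨p1, p2⟩ _ ⟨q1, q2⟩ _ h
    simpa using h
  rw [mem_TN] at hS ⊢
  obtain ⟨⟨h1, h2, h3⟩, h4, h5⟩ := hS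
  refine ⟨⟨?_, ?_, fun v => ?_⟩, ?_, ?_⟩
  · intro p hp
    obtain ⟨q, hq, rfl⟩ := Finset.mem_image.1 hp
    have := h1 q hq
    dsimp only
    omega
  · intro p hp p' hp'
    obtain ⟨q, hq, rfl⟩ := Finset.mem_image.1 hp
    obtain ⟨q', hq', rfl⟩ := Finset.mem_image.1 hp'
    have := h2 q hq q' hq'
    dsimp only
    omega
  · by_cases hv : c ≤ v
    · rw [vdeg_image (v := v - c) inj]
      · exact h3 _
      · intro p hp
        dsimp only
        omega
    · rw [vdeg_eq_zero.2]
      · omega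
      · intro p hp
        obtain ⟨q, hq, rfl⟩ := Finset.mem_image.1 hp
        dsimp only
        omega
  · rw [vdeg_image (v := l) inj]
    · exact h4
    · intro p hp
      dsimp only
      omega
  · rw [vdeg_image (v := r) inj]
    · exact h5
    · intro p hp
      dsimp only
      omega

lemma unshift_mem {m l r a b c : ℕ} {S : Finset (ℕ × ℕ)} (hS : S ∈ TN m (l + c) (r + c) a b) :
    S.image (fun p => (p.1 - c, p.2 - c)) ∈ TN m l r a b := by
  rw [mem_TN] at hS ⊢
  obtain ⟨⟨h1, h2, h3⟩, h4, h5⟩ := hS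
  have inj : Set.InjOn (fun p : ℕ × ℕ => (p.1 - c, p.2 - c)) S := by
    rintro ⟨p1, p2⟩ hp ⟨q1, q2⟩ hq h
    have := h1 _ hp
    have := h1 _ hq
    simp only [Prod.mk.injEq] at h ⊢
    dsimp only at *
    omega
  have dg : ∀ v, vdeg (S.image (fun p => (p.1 - c, p.2 - c))) v = vdeg S (v + c) := by
    intro v
    rw [vdeg_image (v := v + c) inj]
    intro p hp
    have := h1 _ hp
    dsimp only
    omega
  refine ⟨⟨?_, ?_, fun v => ?_⟩, ?_, ?_⟩
  · intro p hp
    obtain ⟨q, hq, rfl⟩ := Finset.mem_image.1 hp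
    have := h1 q hq
    dsimp only
    omega
  · intro p hp p' hp'
    obtain ⟨q, hq, rfl⟩ := Finset.mem_image.1 hp
    obtain ⟨q', hq', rfl⟩ := Finset.mem_image.1 hp'
    have := h2 q hq q' hq'
    have := h1 q hq
    have := h1 q' hq'
    dsimp only
    omega
  · rw [dg]
    exact h3 _
  · rw [dg]
    exact h4
  · rw [dg]
    exact h5

lemma card_shift (m l r a b c : ℕ) :
    (TN m (l + c) (r + c) a b).card = (TN m l r a b).card := by
  symm
  refine Finset.card_nbij' (fun S => S.image (fun p => (p.1 + c, p.2 + c)))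
    (fun S => S.image (fun p => (p.1 - c, p.2 - c))) ?_ ?_ ?_ ?_
  · intro S hS
    exact shift_mem hS
  · intro S hS
    exact unshift_mem hS
  · intro S hS
    dsimp only
    rw [Finset.image_image]
    conv_rhs => rw [← Finset.image_id (s := S)]
    refine Finset.image_congr fun p hp => ?_
    ext <;> simp
  · intro S hS
    dsimp only
    rw [Finset.image_image]
    have h1 := (mem_TN.1 hS).1.1
    conv_rhs => rw [← Finset.image_id (s := S)]
    refine Finset.image_congr fun p hp => ?_
    have := h1 p hp
    ext
    · simp only [Function.comp, id]
      omega
    · simp only [Function.comp, id]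
      omega

lemma refl_mem {m n a b : ℕ} {S : Finset (ℕ × ℕ)} (hS : S ∈ TN m 1 n a b) :
    S.image (fun p => (n + 1 - p.2, n + 1 - p.1)) ∈ TN m 1 n b a := by
  rw [mem_TN] at hS ⊢
  obtain ⟨⟨h1, h2, h3⟩, h4, h5⟩ := hS
  have inj : Set.InjOn (fun p : ℕ × ℕ => (n + 1 - p.2, n + 1 - p.1)) S := by
    rintro ⟨p1, p2⟩ hp ⟨q1, q2⟩ hq h
    have := h1 _ hp
    have := h1 _ hq
    simp only [Prod.mk.injEq] at h ⊢
    dsimp only at *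
    omega
  have dg : ∀ v, v ≤ n + 1 →
      vdeg (S.image (fun p => (n + 1 - p.2, n + 1 - p.1))) v = vdeg S (n + 1 - v) := by
    intro v hv
    rw [vdeg_image (v := n + 1 - v) inj]
    intro p hp
    have := h1 _ hp
    dsimp only
    omega
  refine ⟨⟨?_, ?_, fun v => ?_⟩, ?_, ?_⟩
  · intro p hp
    obtain ⟨q, hq, rfl⟩ := Finset.mem_image.1 hp
    have := h1 q hq
    dsimp only
    omega
  · intro p hp p' hp'
    obtain ⟨q, hq, rfl⟩ := Finset.mem_image.1 hp
    obtain ⟨q', hq', rfl⟩ := Finset.mem_image.1 hp'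
    have := h2 q' hq' q hq
    have := h1 q hq
    have := h1 q' hq'
    dsimp only
    omega
  · by_cases hv : v ≤ n + 1
    · rw [dg v hv]
      exact h3 _
    · rw [vdeg_eq_zero.2]
      · omega
      · intro p hp
        obtain ⟨q, hq, rfl⟩ := Finset.mem_image.1 hp
        dsimp only
        omega
  · rw [dg _ (by omega)]
    exact h5
  · rw [dg _ (by omega)]
    have : n + 1 - n = 1 := by omega
    rw [this]
    exact h4

lemma card_refl (m n a b : ℕ) : (TN m 1 n a b).card = (TN m 1 n b a).card := by
  have inv : ∀ {a b : ℕ} {S : Finset (ℕ × ℕ)}, S ∈ TN m 1 n a b →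
      (S.image (fun p => (n + 1 - p.2, n + 1 - p.1))).image
        (fun p => (n + 1 - p.2, n + 1 - p.1)) = S := by
    intro a b S hS
    rw [Finset.image_image]
    have h1 := (mem_TN.1 hS).1.1
    conv_rhs => rw [← Finset.image_id (s := S)]
    refine Finset.image_congr fun p hp => ?_
    have := h1 p hp
    ext
    · simp only [Function.comp, id]
      omega
    · simp only [Function.comp, id]
      omega
  exact Finset.card_nbij' (fun S => S.image (fun p => (n + 1 - p.2, n + 1 - p.1)))
    (fun S => S.image (fun p => (n + 1 - p.2, n + 1 - p.1)))
    (fun S hS => refl_mem hS) (fun S hS => refl_mem hS) (fun S hS => inv hS) (fun S hS => inv hS)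

/-- Splitting according to the presence of the arc `(l, r)`. -/
lemma card_TN_split {m l r a b : ℕ} (hm : 1 ≤ m) (ha : a ≤ 1) (hb : b ≤ 1) :
    (TN m l r (a + 1) (b + 1)).card =
      (TF m l r (a + 1) (b + 1)).card + if l + m ≤ r then (TF m l r a b).card else 0 := by
  classical
  have h0 := Finset.card_filter_add_card_filter_not (s := TN m l r (a + 1) (b + 1))
    (fun S => (l, r) ∉ S)
  rw [← h0]
  unfold TF
  congr 1
  · split_ifs with hlr
    · symm
      refine Finset.card_nbij' (fun S => insert (l, r) S) (fun S => S.erase (l, r)) ?_ ?_ ?_ ?_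
      · intro S hS
        have hS' := mem_TF.1 hS
        obtain ⟨⟨⟨h1, h2, h3⟩, h4, h5⟩, h6⟩ := hS'
        simp only [Finset.coe_filter, Set.mem_ofPred_eq, mem_TN, not_not]
        refine ⟨⟨⟨?_, ?_, ?_⟩, ?_, ?_⟩, Finset.mem_insert_self _ _⟩
        · intro p hp
          rcases Finset.mem_insert.1 hp with rfl | hp
          · dsimp only
            omega
          · exact h1 p hp
        · intro p hp q hq
          rcases Finset.mem_insert.1 hp with rfl | hp <;> rcases Finset.mem_insert.1 hq with rfl | hq
          · dsimp only
            omega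
          · have := h1 q hq
            dsimp only
            omega
          · have := h1 p hp
            dsimp only
            omega
          · exact h2 p hp q hq
        · intro v
          rw [vdeg_insert h6]
          have := h3 v
          split_ifs with hv
          · dsimp only at hv
            rcases hv with rfl | rfl <;> omega
          · omega
        · rw [vdeg_insert h6]
          simp only [true_or, if_true]
          omega
        · rw [vdeg_insert h6]
          simp only [or_true, if_true]
          omega
      · intro S hS
        simp only [Finset.coe_filter, Set.mem_ofPred_eq, mem_TN, not_not] at hS
        obtain ⟨⟨⟨h1, h2, h3⟩, h4, h5⟩, h6⟩ := hS
        have hd := fun v => vdeg_insert (Finset.notMem_erase (l, r) S) v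
        rw [Finset.insert_erase h6] at hd
        refine mem_TF.2 ⟨⟨⟨?_, ?_, ?_⟩, ?_, ?_⟩, Finset.notMem_erase _ _⟩
        · intro p hp
          exact h1 p (Finset.mem_of_mem_erase hp)
        · intro p hp q hq
          exact h2 p (Finset.mem_of_mem_erase hp) q (Finset.mem_of_mem_erase hq)
        · intro v
          exact (vdeg_mono (Finset.erase_subset _ _) v).trans (h3 v)
        · have := hd l
          simp only [true_or, if_true] at this
          dsimp only
          omega
        · have := hd r
          simp only [or_true, if_true] at this
          dsimp only
          omega
      · intro S hS
        exact Finset.erase_insert (mem_TF.1 hS).2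
      · intro S hS
        simp only [Finset.coe_filter, Set.mem_ofPred_eq, not_not] at hS
        exact Finset.insert_erase hS.2
    · rw [Finset.card_eq_zero, Finset.filter_eq_empty_iff]
      intro S hS
      rw [not_not]
      intro h
      have := (mem_TN.1 hS).1.1 _ h
      dsimp only at this
      omega

open Classical in
/-- Gluing a stack under the arc `(l, j)` with a stack on `[j, r]`. -/
lemma card_glue {m l j r a b : ℕ} (hm : 1 ≤ m) (ha : a ≤ 1) (hlj : l + m ≤ j) (hjr : j < r) :
    ((TF m l r (a + 1) b).filter fun S => (l, j) ∈ S ∧ ∀ k, j < k → (l, k) ∉ S).card =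
      ((TF m l j a 1 ×ˢ TN m j r 1 b).filter fun P => vdeg P.1 j + vdeg P.2 j ≤ 1).card := by
  classical
  symm
  refine Finset.card_nbij' (fun P => insert (l, j) (P.1 ∪ P.2))
    (fun S => (S.filter fun p => p.2 ≤ j ∧ p ≠ (l, j), S.filter fun p => j ≤ p.1)) ?_ ?_ ?_ ?_
  · rintro ⟨S, T⟩ hP
    simp only [Finset.coe_filter, Finset.mem_product, Set.mem_ofPred_eq, mem_TN, mem_TF] at hP
    obtain ⟨⟨⟨⟨⟨h1, h2, h3⟩, h4, h5⟩, h6⟩, ⟨g1, g2, g3⟩, g4, g5⟩, h7⟩ := hP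
    have hdis : Disjoint S T := by
      rw [Finset.disjoint_left]
      intro p hp hq
      have := h1 p hp
      have := g1 p hq
      omega
    have hno : (l, j) ∉ S ∪ T := by
      rw [Finset.mem_union, not_or]
      refine ⟨h6, fun h => ?_⟩
      have := g1 _ h
      dsimp only at this
      omega
    have hS0 : ∀ v, j < v → vdeg S v = 0 := fun v hv => vdeg_eq_zero.2 fun p hp => by
      have := h1 p hp
      omega
    have hT0 : ∀ v, v < j → vdeg T v = 0 := fun v hv => vdeg_eq_zero.2 fun p hp => by
      have := g1 p hp
      omega
    have hd : ∀ v, vdeg (insert (l, j) (S ∪ T)) v =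
        vdeg S v + vdeg T v + if l = v ∨ j = v then 1 else 0 := by
      intro v
      rw [vdeg_insert hno, vdeg_union hdis]
    have hmem : ∀ p, p ∈ insert (l, j) (S ∪ T) ↔ p = (l, j) ∨ p ∈ S ∨ p ∈ T := by
      intro p
      rw [Finset.mem_insert, Finset.mem_union]
    simp only [Finset.coe_filter, Set.mem_ofPred_eq, mem_TF]
    refine ⟨⟨⟨⟨?_, ?_, ?_⟩, ?_, ?_⟩, ?_⟩, ?_, ?_⟩
    · intro p hp
      rcases (hmem p).1 hp with rfl | hp | hp
      · dsimp only
        omega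
      · have := h1 p hp
        omega
      · have := g1 p hp
        omega
    · intro p hp q hq
      rcases (hmem p).1 hp with rfl | hp | hp <;> rcases (hmem q).1 hq with rfl | hq | hq
      · dsimp only
        omega
      · have := h1 q hq
        dsimp only
        omega
      · have := g1 q hq
        dsimp only
        omega
      · have := h1 p hp
        dsimp only
        omega
      · exact h2 p hp q hq
      · have := h1 p hp
        have := g1 q hq
        omega
      · have := g1 p hp
        dsimp only
        omega
      · have := g1 p hp
        have := h1 q hq
        omega
      · exact g2 p hp q hq
    · intro v
      rw [hd]
      rcases lt_trichotomy v j with hv | rfl | hv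
      · rw [hT0 v hv]
        have := h3 v
        split_ifs with h
        · have : l = v := by omega
          subst this
          omega
        · omega
      · simp only [or_true, if_true]
        omega
      · rw [hS0 v hv, if_neg (by omega)]
        have := g3 v
        omega
    · rw [hd, hT0 l (by omega)]
      simp only [true_or, if_true]
      omega
    · rw [hd, hS0 r (by omega), if_neg (by omega)]
      omega
    · rw [hmem]
      rintro (h | h | h)
      · simp only [Prod.mk.injEq] at h
        omega
      · have := h1 _ h
        dsimp only at this
        omega
      · have := g1 _ h
        dsimp only at this
        omega
    · rw [hmem]
      exact Or.inl rfl
    · intro k hk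
      rw [hmem]
      rintro (h | h | h)
      · simp only [Prod.mk.injEq] at h
        omega
      · have := h1 _ h
        dsimp only at this
        omega
      · have := g1 _ h
        dsimp only at this
        omega
  · intro U hU
    simp only [Finset.coe_filter, Set.mem_ofPred_eq, mem_TF] at hU
    obtain ⟨⟨⟨⟨h1, h2, h3⟩, h4, h5⟩, h6⟩, h7, h8⟩ := hU
    have hrec : insert (l, j) ((U.filter fun p => p.2 ≤ j ∧ p ≠ (l, j)) ∪
        (U.filter fun p => j ≤ p.1)) = U := by
      ext p
      simp only [Finset.mem_insert, Finset.mem_union, Finset.mem_filter]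
      constructor
      · rintro (rfl | h | h)
        · exact h7
        · exact h.1
        · exact h.1
      · intro hp
        by_cases hpe : p = (l, j)
        · exact Or.inl hpe
        · by_cases h : p.2 ≤ j
          · exact Or.inr (Or.inl ⟨hp, h, hpe⟩)
          · refine Or.inr (Or.inr ⟨hp, ?_⟩)
            by_contra hlt
            have a1 := h2 _ h7 _ hp
            have a2 := h1 _ hp
            dsimp only at a1
            have : p.1 = l := by omega
            refine h8 p.2 (by omega) ?_
            rw [← this]
            exact hp
    generalize hS : (U.filter fun p => p.2 ≤ j ∧ p ≠ (l, j)) = S at hrec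
    generalize hT : (U.filter fun p => j ≤ p.1) = T at hrec
    have hSm : ∀ p, p ∈ S ↔ p ∈ U ∧ p.2 ≤ j ∧ p ≠ (l, j) := by
      intro p
      rw [← hS, Finset.mem_filter]
    have hTm : ∀ p, p ∈ T ↔ p ∈ U ∧ j ≤ p.1 := by
      intro p
      rw [← hT, Finset.mem_filter]
    have hdis : Disjoint S T := by
      rw [Finset.disjoint_left]
      intro p hp hq
      rw [hSm] at hp
      rw [hTm] at hq
      have := h1 p hp.1
      omega
    have hno : (l, j) ∉ S ∪ T := by
      rw [Finset.mem_union, not_or, hSm, hTm]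
      refine ⟨fun h => h.2.2 rfl, fun h => ?_⟩
      have := h.2
      dsimp only at this
      omega
    have hd : ∀ v, vdeg U v =
        vdeg S v + vdeg T v + if l = v ∨ j = v then 1 else 0 := by
      intro v
      rw [← hrec, vdeg_insert hno, vdeg_union hdis]
    have dl := hd l
    have dj := hd j
    have dr := hd r
    have d3 := h3 j
    simp only [true_or, or_true, if_true] at dl dj
    simp only [Finset.coe_filter, Finset.mem_product, Set.mem_ofPred_eq, mem_TN, mem_TF, hS, hT]
    refine ⟨⟨⟨⟨⟨?_, ?_, ?_⟩, ?_, ?_⟩, ?_⟩, ⟨?_, ?_, ?_⟩, ?_, ?_⟩, ?_⟩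
    · intro p hp
      have hp := (hSm p).1 hp
      have := h1 p hp.1
      omega
    · intro p hp q hq
      exact h2 p ((hSm p).1 hp).1 q ((hSm q).1 hq).1
    · intro v
      have := hd v
      have := h3 v
      omega
    · omega
    · omega
    · rw [hSm]
      exact fun h => h.2.2 rfl
    · intro p hp
      have hp := (hTm p).1 hp
      have := h1 p hp.1
      omega
    · intro p hp q hq
      exact h2 p ((hTm p).1 hp).1 q ((hTm q).1 hq).1
    · intro v
      have := hd v
      have := h3 v
      omega
    · omega
    · omega
    · omega
  · rintro ⟨S, T⟩ hP
    simp only [Finset.coe_filter, Finset.mem_product, Set.mem_ofPred_eq, mem_TN, mem_TF] at hP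
    obtain ⟨⟨⟨⟨⟨h1, h2, h3⟩, h4, h5⟩, h6⟩, ⟨g1, g2, g3⟩, g4, g5⟩, h7⟩ := hP
    simp only [Prod.mk.injEq]
    constructor
    · ext p
      simp only [Finset.mem_insert, Finset.mem_union, Finset.mem_filter]
      constructor
      · rintro ⟨h | h | h, hh, hne⟩
        · exact absurd h hne
        · exact h
        · have := g1 p h
          omega
      · intro hp
        refine ⟨Or.inr (Or.inl hp), (h1 p hp).2.2.1, ?_⟩
        rintro rfl
        exact h6 hp
    · ext p
      simp only [Finset.mem_insert, Finset.mem_union, Finset.mem_filter]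
      constructor
      · rintro ⟨rfl | h | h, hh⟩
        · dsimp only at hh
          omega
        · have := h1 p h
          omega
        · exact h
      · intro hp
        exact ⟨Or.inr (Or.inr hp), (g1 p hp).1⟩
  · intro U hU
    simp only [Finset.coe_filter, Set.mem_ofPred_eq, mem_TF] at hU
    obtain ⟨⟨⟨⟨h1, h2, h3⟩, h4, h5⟩, h6⟩, h7, h8⟩ := hU
    ext p
    simp only [Finset.mem_insert, Finset.mem_union, Finset.mem_filter]
    constructor
    · rintro (rfl | h | h)
      · exact h7
      · exact h.1
      · exact h.1
    · intro hp
      by_cases hpe : p = (l, j)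
      · exact Or.inl hpe
      · by_cases h : p.2 ≤ j
        · exact Or.inr (Or.inl ⟨hp, h, hpe⟩)
        · refine Or.inr (Or.inr ⟨hp, ?_⟩)
          by_contra hlt
          have a1 := h2 _ h7 _ hp
          have a2 := h1 _ hp
          dsimp only at a1
          have : p.1 = l := by omega
          refine h8 p.2 (by omega) ?_
          rw [← this]
          exact hp

lemma card_pairs (m l j r a b : ℕ) :
    (((TF m l j a 1 ×ˢ TN m j r 1 b).filter fun P => vdeg P.1 j + vdeg P.2 j ≤ 1).card : ℤ) =
      (TF m l j a 0).card * (TN m j r 1 b).card +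
        ((TF m l j a 1).card - (TF m l j a 0).card) * (TN m j r 0 b).card := by
  classical
  have hsub : TF m l j a 0 ⊆ TF m l j a 1 := by
    intro S hS
    rw [mem_TF] at hS ⊢
    exact ⟨⟨hS.1.1, hS.1.2.1, by omega⟩, hS.2⟩
  have heq : ((TF m l j a 1 ×ˢ TN m j r 1 b).filter fun P => vdeg P.1 j + vdeg P.2 j ≤ 1) =
      (TF m l j a 0 ×ˢ TN m j r 1 b) ∪ ((TF m l j a 1 \ TF m l j a 0) ×ˢ TN m j r 0 b) := by
    ext ⟨S, T⟩
    simp only [Finset.mem_filter, Finset.mem_product, Finset.mem_union, Finset.mem_sdiff,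
      mem_TF, mem_TN]
    by_cases h : vdeg S j = 0
    · have e1 : vdeg S j ≤ 1 := by omega
      have e2 : vdeg S j ≤ 0 := by omega
      have e3 : (vdeg S j + vdeg T j ≤ 1) ↔ vdeg T j ≤ 1 := by omega
      rw [e3]
      simp only [e1, e2]
      tauto
    · have e2 : ¬ vdeg S j ≤ 0 := by omega
      have e3 : (vdeg S j + vdeg T j ≤ 1) ↔ (vdeg S j ≤ 1 ∧ vdeg T j ≤ 0) := by omega
      have e4 : vdeg T j ≤ 0 → vdeg T j ≤ 1 := by omega
      rw [e3]
      simp only [e2]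
      tauto
  have hdis : Disjoint (TF m l j a 0 ×ˢ TN m j r 1 b)
      ((TF m l j a 1 \ TF m l j a 0) ×ˢ TN m j r 0 b) := by
    rw [Finset.disjoint_left]
    rintro ⟨S, T⟩ h1 h2
    rw [Finset.mem_product] at h1 h2
    exact (Finset.mem_sdiff.1 h2.1).2 h1.1
  rw [heq, Finset.card_union_of_disjoint hdis, Finset.card_product, Finset.card_product,
    Finset.card_sdiff_of_subset hsub]
  push_cast [Nat.cast_sub (Finset.card_le_card hsub)]
  ring

/-- The last neighbour of `l` (or `0`). -/
def topNb (l : ℕ) (S : Finset (ℕ × ℕ)) : ℕ := (S.filter fun p => p.1 = l).sup Prod.snd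

lemma topNb_le {l k : ℕ} {S : Finset (ℕ × ℕ)} (h : (l, k) ∈ S) : k ≤ topNb l S :=
  Finset.le_sup (f := Prod.snd) (b := (l, k)) (Finset.mem_filter.2 ⟨h, rfl⟩)

lemma topNb_mem {l : ℕ} {S : Finset (ℕ × ℕ)} (h : topNb l S ≠ 0) : (l, topNb l S) ∈ S := by
  have hne : (S.filter fun p => p.1 = l).Nonempty := by
    rw [Finset.nonempty_iff_ne_empty]
    intro he
    apply h
    rw [topNb, he, Finset.sup_empty]
    rfl
  obtain ⟨p, hp, hs⟩ := Finset.exists_mem_eq_sup _ hne Prod.snd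
  rw [Finset.mem_filter] at hp
  rw [topNb, hs, ← hp.2]
  exact hp.1

lemma card_TF_succ {m l r a b : ℕ} (hm : 1 ≤ m) (ha : a ≤ 1) :
    ((TF m l r (a + 1) b).card : ℤ) = (TN m (l + 1) r 2 b).card +
      ∑ j ∈ Finset.Ico (l + m) r, ((TF m l j a 0).card * (TN m j r 1 b).card +
        ((TF m l j a 1).card - (TF m l j a 0).card) * (TN m j r 0 b).card : ℤ) := by
  classical
  have hmaps : Set.MapsTo (topNb l) (TF m l r (a + 1) b : Set (Finset (ℕ × ℕ)))
      (insert 0 (Finset.Ico (l + m) r) : Finset ℕ) := by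
    intro S hS
    have hS := mem_TF.1 hS
    simp only [Finset.coe_insert, Set.mem_insert_iff, Finset.coe_Ico, Set.mem_Ico]
    by_cases h : topNb l S = 0
    · exact Or.inl h
    · right
      have h' := topNb_mem h
      have := hS.1.1.1 _ h'
      dsimp only at this
      refine ⟨by omega, lt_of_le_of_ne (by omega) ?_⟩
      intro he
      rw [he] at h'
      exact hS.2 h'
  rw [Finset.card_eq_sum_card_fiberwise hmaps, Finset.sum_insert (by simp; omega)]
  push_cast
  congr 1
  · rw [← TN_zero_left]
    congr 2
    ext S
    rw [Finset.mem_filter, mem_TF, mem_TN, Nat.le_zero, vdeg_eq_zero]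
    constructor
    · rintro ⟨⟨⟨h1, h2, h3⟩, h4⟩, h5⟩
      refine ⟨h1, fun p hp => ?_, h3⟩
      have := h1.1 p hp
      refine ⟨fun h => ?_, by omega⟩
      have := topNb_le (l := l) (k := p.2) (S := S) (by rw [← h]; exact hp)
      omega
    · rintro ⟨h1, h2, h3⟩
      refine ⟨⟨⟨h1, ?_, h3⟩, fun h => (h2 _ h).1 rfl⟩, ?_⟩
      · rw [vdeg_eq_zero.2 h2]
        omega
      · by_contra h
        exact (h2 _ (topNb_mem h)).1 rfl
  · refine Finset.sum_congr rfl fun j hj => ?_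
    rw [Finset.mem_Ico] at hj
    rw [← card_pairs, ← card_glue hm ha hj.1 hj.2]
    refine congrArg (fun T : Finset (Finset (ℕ × ℕ)) => (T.card : ℤ))
      (Finset.filter_congr fun S hS => ?_)
    constructor
    · rintro rfl
      refine ⟨topNb_mem (by omega), fun k hk h => ?_⟩
      have := topNb_le h
      omega
    · rintro ⟨h1, h2⟩
      have a1 := topNb_le h1
      by_contra hne
      exact h2 _ (by omega) (topNb_mem (l := l) (S := S) (by omega))

lemma stack_alg {R : Type*} [CommRing R] [IsDomain R] (x y S U V A B C W : R)
    (hz : 1 - x ≠ 0)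
    (hU : U = 1 + x * V)
    (h1 : V = S + A * (V - S) + B * S)
    (h2 : S = 1 + x * (S + B * (V - S) + C * S))
    (h3 : C = A * (W - U) + B * U)
    (h4 : (1 - x) * W = 1 - y + (1 - x) * (C + A))
    (hA : (1 - x) * A = (1 - x) * x * S - x + y)
    (hB : (1 - x) * B = (1 - x) * U - 1 + y) :
    (4 * x ^ 5 * (x - 1) ^ 4) * S ^ 5 +
    (-11 * (y * x ^ 7) + 4 * x ^ 8 + 33 * (y * x ^ 6) - x ^ 7 - 33 * (y * x ^ 5) -
      25 * x ^ 6 + 11 * (y * x ^ 4) + 41 * x ^ 5 - 23 * x ^ 4 + 4 * x ^ 3) * S ^ 4 +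
    (11 * (y ^ 2 * x ^ 5) - 8 * (y * x ^ 6) - 22 * (y ^ 2 * x ^ 4) - 6 * (y * x ^ 5) +
      11 * (y ^ 2 * x ^ 3) + 8 * x ^ 6 + 44 * (y * x ^ 4) - 5 * x ^ 5 - 38 * (y * x ^ 3) -
      22 * x ^ 4 + 8 * (y * x ^ 2) + 27 * x ^ 3 - 8 * x ^ 2) * S ^ 3 +
    (-5 * (y ^ 3 * x ^ 3) + 6 * (y ^ 2 * x ^ 4) + 5 * (y ^ 3 * x ^ 2) + 3 * (y * x ^ 5) +
      8 * (y ^ 2 * x ^ 3) - 21 * (y * x ^ 4) - 19 * (y ^ 2 * x ^ 2) - 3 * x ^ 5 +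
      8 * (y * x ^ 3) + 5 * (y ^ 2 * x) + 15 * x ^ 4 + 20 * (y * x ^ 2) - 11 * x ^ 3 -
      10 * (y * x) - 6 * x ^ 2 + 5 * x) * S ^ 2 +
    (y ^ 4 * x - 2 * (y ^ 3 * x ^ 2) - 3 * (y ^ 2 * x ^ 3) - 3 * (y ^ 3 * x) +
      12 * (y ^ 2 * x ^ 2) + y ^ 3 + 6 * (y * x ^ 3) - 18 * (y * x ^ 2) - 3 * y ^ 2 -
      3 * x ^ 3 + 5 * (y * x) + 8 * x ^ 2 + 3 * y - 3 * x - 1) * S +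
    (y ^ 3 * x - y ^ 3 - 3 * (y ^ 2 * x) + 3 * y ^ 2 +
      3 * (y * x) - 3 * y - x + 1) = 0 := by
  have hC : C * (1 - A) = A ^ 2 - A * B + B * U := by
    apply mul_left_cancel₀ hz
    linear_combination (1 - x) * h3 + A * h4 + A * hB
  have hD : U * (1 - A - x * S) * (1 - x)
      = (1 - x) * (1 - A) * (1 + x * S) - x * (1 - y) * S := by
    linear_combination (1 - x) * x * h1 + (1 - x) * (1 - A) * hU + x * S * hB
  have hG : (1 - A) * (1 + B * (U - 1) - x * B * S - (1 - x) * S)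
      + x * S * (A ^ 2 - A * B + B * U) = 0 := by
    linear_combination (-(1 - A)) * h2 - x * S * hC + (1 - A) * B * hU
  generalize ha : (1 - x) * x * S - x + y = a at hA
  have hG2 : (1 - x - a) * ((1 - x) + ((1 - x) * U - 1 + y) * (U - 1)
      - x * ((1 - x) * U - 1 + y) * S - (1 - x) ^ 2 * S)
      + x * S * (a ^ 2 - a * ((1 - x) * U - 1 + y) + (1 - x) * ((1 - x) * U - 1 + y) * U) = 0 := by
    rw [← hA, ← hB]
    linear_combination (1 - x) ^ 2 * hG
  have hD2 : U * (1 - x - a - (1 - x) * x * S)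
      = (1 - x - a) * (1 + x * S) - x * (1 - y) * S := by
    rw [← hA]; linear_combination hD
  subst ha
  set z := 1 - x with hzdef
  set a := z * x * S - x + y with hadef
  set E := z - a - z * x * S with hE
  set N := (z - a) * (1 + x * S) - x * (1 - y) * S with hN
  have key := hG2
  have e : ((z - a) * z + x * S * z ^ 2) * N ^ 2
      + ((z - a) * (-1 + y - z - x * z * S) + x * S * (-a * z + z * (-1 + y))) * (N * E)
      + ((z - a) * (z - (-1 + y) - x * (-1 + y) * S - z ^ 2 * S)
        + x * S * (a ^ 2 - a * (-1 + y))) * E ^ 2 = 0 := by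
    rw [← hD2]
    linear_combination E ^ 2 * hG2
  rw [← e, hN, hE, hadef, hzdef]
  ring

/-- Number of stacks on `[n]` with degree bounds at the end points. -/
noncomputable def nN (m n a b : ℕ) : ℤ := ((TN m 1 n a b).card : ℤ)

/-- Number of stacks on `[n]` avoiding the arc `(1, n)`, with degree bounds. -/
noncomputable def nF (m n a b : ℕ) : ℤ := ((TF m 1 n a b).card : ℤ)

lemma nN_short {m n a b : ℕ} (h : n ≤ m) : nN m n a b = 1 := by
  unfold nN
  rw [card_TN_short (by omega)]
  rfl

lemma nN_zero_left (m n b : ℕ) : nN m (n + 1) 0 b = nN m n 2 b := by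
  unfold nN
  rw [TN_zero_left, card_shift m 1 n 2 b 1]

lemma nN_zero_right (m n a : ℕ) : nN m (n + 1) a 0 = nN m n a 2 := by
  unfold nN
  rw [TN_zero_right]

lemma nN_refl (m n : ℕ) : nN m n 2 1 = nN m n 1 2 := by
  unfold nN
  rw [card_refl]

lemma nF_zero_left (m n b : ℕ) : nF m (n + 1) 0 b = nN m n 2 b := by
  rw [← nN_zero_left, nF, TF_zero_left, nN]

lemma nF_zero_right (m n a : ℕ) : nF m (n + 1) a 0 = nN m n a 2 := by
  rw [← nN_zero_right, nF, TF_zero_right, nN]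

lemma nN_split {m n a b : ℕ} (hm : 1 ≤ m) (ha : a ≤ 1) (hb : b ≤ 1) :
    nN m (n + 1) (a + 1) (b + 1) =
      nF m (n + 1) (a + 1) (b + 1) + if m ≤ n then nF m (n + 1) a b else 0 := by
  unfold nN nF
  rw [card_TN_split hm ha hb]
  have : (1 + m ≤ n + 1) ↔ m ≤ n := by omega
  simp only [this]
  push_cast
  rfl

lemma nF_succ {m n a b : ℕ} (hm : 1 ≤ m) (ha : a ≤ 1) :
    nF m (n + 1) (a + 1) b = nN m n 2 b + ∑ i ∈ Finset.range n, if m ≤ i then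
      nF m (i + 1) a 0 * (nN m (n - i + 1) 1 b - nN m (n - i) 2 b)
        + nF m (i + 1) a 1 * nN m (n - i) 2 b else 0 := by
  have hset : (Finset.range n).filter (fun i => m ≤ i) = Finset.Ico m n := by
    ext i
    simp only [Finset.mem_filter, Finset.mem_range, Finset.mem_Ico]
    omega
  rw [← Finset.sum_filter, hset]
  unfold nF nN
  rw [card_TF_succ hm ha, card_shift m 1 n 2 b 1, add_comm 1 m, ← Finset.sum_Ico_add']
  congr 1
  refine Finset.sum_congr rfl fun i hi => ?_
  rw [Finset.mem_Ico] at hi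
  have e1 := card_shift m 1 (n - i + 1) 1 b i
  have e2 := card_shift m 1 (n - i) 2 b (i + 1)
  rw [show 1 + i = i + 1 by omega, show n - i + 1 + i = n + 1 by omega] at e1
  rw [show 1 + (i + 1) = i + 1 + 1 by omega, show n - i + (i + 1) = n + 1 by omega] at e2
  rw [TN_zero_left, e1, e2]
  ring

lemma nF_succ_split {m n a b : ℕ} (hm : 1 ≤ m) (ha : a ≤ 1) :
    nF m (n + 1) (a + 1) b = nN m n 2 b + (∑ i ∈ Finset.range n, if m ≤ i then
      nF m (i + 1) a 0 * (nN m (n - i + 1) 1 b - nN m (n - i) 2 b) else 0) +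
      ∑ i ∈ Finset.range n, if m ≤ i then nF m (i + 1) a 1 * nN m (n - i) 2 b else 0 := by
  rw [nF_succ hm ha, add_assoc, ← Finset.sum_add_distrib]
  congr 1
  refine Finset.sum_congr rfl fun i _ => ?_
  split_ifs <;> ring

lemma sCount_eq (m n : ℕ) (hm : 1 ≤ m) : (sCount m 2 n : ℤ) = nN m n 2 2 := by
  unfold sCount nN
  have : {S : Finset (ℕ × ℕ) | IsStack m 2 n S} = (TN m 1 n 2 2 : Set (Finset (ℕ × ℕ))) := by
    ext S
    rw [Set.mem_ofPred_eq, Finset.mem_coe, mem_TN]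
    unfold IsStack IsContactStack ArcsRegular GoodOn
    constructor
    · rintro ⟨⟨h1, h2, h3⟩, h4⟩
      refine ⟨⟨fun p hp => ?_, h2, h3⟩, h3 _, h3 _⟩
      have := h1 p hp
      have := h4 p hp
      omega
    · rintro ⟨⟨h1, h2, h3⟩, -, -⟩
      refine ⟨⟨fun p hp => ?_, h2, h3⟩, fun p hp => ?_⟩
      · have := h1 p hp
        omega
      · have := h1 p hp
        omega
  rw [this, Set.ncard_coe_finset]

/-- The recurrence with the last term of the convolution added. -/
lemma conv_term {m : ℕ} (f : ℕ → ℤ) (g : ℕ → ℤ) (n : ℕ) :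
    PowerSeries.coeff n (PowerSeries.mk (fun i => if m ≤ i then f i else 0) * PowerSeries.mk g) =
      (∑ i ∈ Finset.range n, if m ≤ i then f i * g (n - i) else 0)
        + if m ≤ n then f n * g 0 else 0 := by
  rw [PowerSeries.coeff_mul, Finset.Nat.sum_antidiagonal_eq_sum_range_succ_mk,
    Finset.sum_range_succ]
  simp only [PowerSeries.coeff_mk, ite_mul, zero_mul, Nat.sub_self]

theorem series_system (m : ℕ) (hm : 1 ≤ m) : ∃ U V A B C W : PowerSeries ℤ,
    U = 1 + PowerSeries.X * V ∧
    V = Sps m 2 + A * (V - Sps m 2) + B * Sps m 2 ∧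
    Sps m 2 = 1 + PowerSeries.X * (Sps m 2 + B * (V - Sps m 2) + C * Sps m 2) ∧
    C = A * (W - U) + B * U ∧
    (1 - PowerSeries.X) * W = 1 - PowerSeries.X ^ m + (1 - PowerSeries.X) * (C + A) ∧
    (1 - PowerSeries.X) * A = (1 - PowerSeries.X) * PowerSeries.X * Sps m 2
      - PowerSeries.X + PowerSeries.X ^ m ∧
    (1 - PowerSeries.X) * B = (1 - PowerSeries.X) * U - 1 + PowerSeries.X ^ m := by
  have hS : Sps m 2 = PowerSeries.mk fun n => nN m n 2 2 := by
    unfold Sps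
    congr 1
    funext n
    exact sCount_eq m n hm
  rw [hS]
  obtain ⟨I, hI⟩ : ∃ I : PowerSeries ℤ, I = PowerSeries.mk fun i => if i < m then 1 else 0 :=
    ⟨_, rfl⟩
  have hzI : (1 - PowerSeries.X) * I = 1 - PowerSeries.X ^ m := by
    rw [hI, sub_mul, one_mul]
    ext n
    cases n with
    | zero =>
      simp only [map_sub, PowerSeries.coeff_mk, PowerSeries.coeff_zero_X_mul,
        PowerSeries.coeff_one, PowerSeries.coeff_X_pow]
      split_ifs <;> omega
    | succ k =>
      simp only [map_sub, PowerSeries.coeff_mk, PowerSeries.coeff_succ_X_mul,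
        PowerSeries.coeff_one, PowerSeries.coeff_X_pow]
      rw [if_neg (by omega : ¬ k + 1 = 0)]
      rcases lt_trichotomy (k + 1) m with h | h | h
      · rw [if_pos h, if_pos (by omega), if_neg (by omega)]
        ring
      · rw [if_neg (by omega), if_pos (by omega), if_pos h]
      · rw [if_neg (by omega), if_neg (by omega), if_neg (by omega)]
  have f00 : ∀ i, m ≤ i → nF m (i + 1) 0 0 = nN m (i - 1) 2 2 := by
    intro i hi
    obtain ⟨k, rfl⟩ : ∃ k, i = k + 1 := ⟨i - 1, by omega⟩
    rw [nF_zero_right, nN_zero_left]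
    rfl
  have f01 : ∀ i, nF m (i + 1) 0 1 = nN m i 1 2 := by
    intro i
    rw [nF_zero_left, nN_refl]
  have f10 : ∀ i, nF m (i + 1) 1 0 = nN m i 1 2 := fun i => nF_zero_right m i 1
  refine ⟨PowerSeries.mk fun n => nN m n 1 2, PowerSeries.mk fun n => nN m (n + 1) 1 2,
    PowerSeries.mk fun i => if m ≤ i then nF m (i + 1) 0 0 else 0,
    PowerSeries.mk fun i => if m ≤ i then nN m i 1 2 else 0,
    PowerSeries.mk fun i => if m ≤ i then nF m (i + 1) 1 1 else 0,
    PowerSeries.mk fun n => nN m (n + 1) 1 1, ?_, ?_, ?_, ?_, ?_, ?_, ?_⟩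
  · ext n
    cases n with
    | zero => simp [nN_short]
    | succ k => simp [PowerSeries.coeff_succ_X_mul, PowerSeries.coeff_one]
  · have e : ∀ f g : ℕ → ℤ, PowerSeries.mk f - PowerSeries.mk g =
        PowerSeries.mk (fun n => f n - g n) := by
      intro f g
      ext n
      simp
    rw [e]
    ext n
    rw [map_add, map_add, conv_term, conv_term, PowerSeries.coeff_mk, PowerSeries.coeff_mk,
      nN_split hm (a := 0) (b := 1) (by omega) (by omega), nF_succ_split hm (by omega)]
    have z1 : nN m (0 + 1) 1 2 = 1 := nN_short (by omega)
    have z2 : nN m 0 2 2 = 1 := nN_short (by omega)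
    rw [z1, z2]
    simp only [Nat.zero_add, f01]
    split_ifs <;> ring
  · have e : ∀ f g : ℕ → ℤ, PowerSeries.mk f - PowerSeries.mk g =
        PowerSeries.mk (fun n => f n - g n) := by
      intro f g
      ext n
      simp
    rw [e]
    ext k
    cases k with
    | zero => simp [nN_short]
    | succ n =>
      rw [map_add, PowerSeries.coeff_succ_X_mul, map_add, map_add, conv_term, conv_term,
        PowerSeries.coeff_mk, PowerSeries.coeff_mk, PowerSeries.coeff_one,
        nN_split hm (a := 1) (b := 1) (by omega) (by omega), nF_succ_split hm (by omega)]
      have z1 : nN m (0 + 1) 1 2 = 1 := nN_short (by omega)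
      have z2 : nN m 0 2 2 = 1 := nN_short (by omega)
      rw [z1, z2]
      simp only [Nat.reduceAdd, f10]
      rw [if_neg (by omega : ¬ (n + 1 = 0))]
      split_ifs <;> ring
  · have e : ∀ f g : ℕ → ℤ, PowerSeries.mk f - PowerSeries.mk g =
        PowerSeries.mk (fun n => f n - g n) := by
      intro f g
      ext n
      simp
    rw [e]
    ext n
    rw [map_add, conv_term, conv_term, PowerSeries.coeff_mk]
    have z1 : nN m (0 + 1) 1 1 = 1 := nN_short (by omega)
    have z2 : nN m 0 1 2 = 1 := nN_short (by omega)
    rw [z1, z2]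
    by_cases hn : m ≤ n
    · simp only [if_pos hn]
      rw [nF_succ_split hm (a := 0) (by omega)]
      simp only [Nat.zero_add, f01, nN_refl]
      ring
    · simp only [if_neg hn]
      have hz : ∀ F : ℕ → ℤ, ∑ i ∈ Finset.range n, (if m ≤ i then F i else 0) = 0 := by
        intro F
        refine Finset.sum_eq_zero fun i hi => ?_
        rw [Finset.mem_range] at hi
        rw [if_neg (by omega)]
      rw [hz, hz]
      ring
  · rw [← hzI, ← mul_add]
    congr 1
    rw [hI]
    ext n
    simp only [map_add, PowerSeries.coeff_mk]
    by_cases hn : m ≤ n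
    · rw [nN_split hm (a := 0) (b := 0) (by omega) (by omega)]
      simp only [if_pos hn, if_neg (by omega : ¬ n < m)]
      ring
    · simp only [if_neg hn, if_pos (by omega : n < m)]
      rw [nN_short (by omega)]
      ring
  · have hA : (PowerSeries.mk fun i => if m ≤ i then nF m (i + 1) 0 0 else 0) =
        PowerSeries.X * (PowerSeries.mk fun n => nN m n 2 2) - I + 1 := by
      rw [hI]
      ext n
      cases n with
      | zero =>
        simp only [map_add, map_sub, PowerSeries.coeff_mk, PowerSeries.coeff_zero_X_mul,
          PowerSeries.coeff_one]
        rw [if_neg (by omega), if_pos (by omega)]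
        simp
      | succ k =>
        simp only [map_add, map_sub, PowerSeries.coeff_mk, PowerSeries.coeff_succ_X_mul,
          PowerSeries.coeff_one]
        by_cases hn : m ≤ k + 1
        · rw [if_pos hn, if_neg (by omega), f00 _ hn]
          simp
        · rw [if_neg hn, if_pos (by omega), nN_short (by omega)]
          simp
    rw [hA]
    linear_combination -hzI
  · have hB : (PowerSeries.mk fun i => if m ≤ i then nN m i 1 2 else 0) =
        (PowerSeries.mk fun n => nN m n 1 2) - I := by
      rw [hI]
      ext n
      simp only [map_sub, PowerSeries.coeff_mk]
      by_cases hn : m ≤ n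
      · rw [if_pos hn, if_neg (by omega)]
        simp
      · rw [if_neg hn, if_pos (by omega), nN_short (by omega)]
        simp
    rw [hB]
    linear_combination -hzI


theorem stmt16 (m : ℕ) (hm : 1 ≤ m) :
    ∑ k ∈ Finset.range 6, cm2 m k * (Sps m 2) ^ k = 0 := by
  obtain ⟨U, V, A, B, C, W, hU, h1, h2, h3, h4, hA, hB⟩ := series_system m hm
  have hz : (1 - PowerSeries.X : PowerSeries ℤ) ≠ 0 := by
    intro h
    have := congrArg (PowerSeries.coeff 0) h
    simp at this
  have key := stack_alg PowerSeries.X (PowerSeries.X ^ m) (Sps m 2) U V A B C W hz hU h1 h2 h3 h4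
    hA hB
  rw [← key]
  simp only [Finset.sum_range_succ, Finset.sum_range_zero, cm2, cm2.X]
  ring
end

section
/- The generating function S_{1,3}(x) = Σ_{n≥0} s_{1,3}(n) xⁿ of 1-regular 3-contact stacks satisfies, as formal power series over ℤ, the polynomial equation Σ_{k=0}^{15} c_k(x)·S_{1,3}(x)^k = 0, where c_0 = 1; c_1 = x; c_2 = 52x² + x − 1; c_3 = 60x³ − 5x²; c_4 = 787x⁴ − 115x³ − 45x²; c_5 = 871x⁵ − 376x⁴ − 3x³; c_6 = 5731x⁶ − 511x⁵ − 1314x⁴ + 162x³; c_7 = 8188x⁷ − 7823x⁶ + 315x⁵; c_8 = 21690x⁸ − 4575x⁷ − 5483x⁶ − 702x⁵ + 729x⁴; c_9 = 35452x⁹ − 37272x⁸ − 10146x⁷ + 7938x⁶; c_10 = 53179x¹⁰ − 50388x⁹ + 11385x⁸ + 3888x⁷; c_11 = 63508x¹¹ − 84400x¹⁰ + 11576x⁹ + 6912x⁸; c_12 = 65208x¹² − 79736x¹¹ + 39360x¹⁰; c_13 = 53304x¹³ − 69312x¹² + 18432x¹¹; c_14 = 34304x¹⁴ − 38912x¹³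 + 16384x¹²; c_15 = 10240x¹⁵ − 16384x¹⁴. -/
/-- The coefficients `c_{1,3,k}(x)` of the algebraic equation satisfied by `S_{1,3}(x)`. -/
noncomputable def c13 : ℕ → PowerSeries ℤ
  | 0 => 1
  | 1 => X
  | 2 => 52 * X ^ 2 + X - 1
  | 3 => 60 * X ^ 3 - 5 * X ^ 2
  | 4 => 787 * X ^ 4 - 115 * X ^ 3 - 45 * X ^ 2
  | 5 => 871 * X ^ 5 - 376 * X ^ 4 - 3 * X ^ 3
  | 6 => 5731 * X ^ 6 - 511 * X ^ 5 - 1314 * X ^ 4 + 162 * X ^ 3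
  | 7 => 8188 * X ^ 7 - 7823 * X ^ 6 + 315 * X ^ 5
  | 8 => 21690 * X ^ 8 - 4575 * X ^ 7 - 5483 * X ^ 6 - 702 * X ^ 5 + 729 * X ^ 4
  | 9 => 35452 * X ^ 9 - 37272 * X ^ 8 - 10146 * X ^ 7 + 7938 * X ^ 6
  | 10 => 53179 * X ^ 10 - 50388 * X ^ 9 + 11385 * X ^ 8 + 3888 * X ^ 7
  | 11 => 63508 * X ^ 11 - 84400 * X ^ 10 + 11576 * X ^ 9 + 6912 * X ^ 8
  | 12 => 65208 * X ^ 12 - 79736 * X ^ 11 + 39360 * X ^ 10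
  | 13 => 53304 * X ^ 13 - 69312 * X ^ 12 + 18432 * X ^ 11
  | 14 => 34304 * X ^ 14 - 38912 * X ^ 13 + 16384 * X ^ 12
  | 15 => 10240 * X ^ 15 - 16384 * X ^ 14
  | _ => 0
where X : PowerSeries ℤ := PowerSeries.X

theorem alg_elim {R : Type*} [CommRing R] (S y p q α β γ : R)
    
    (h1 : -y*p + (1-q+y)*q - (1+p-q)*y = 0)
    (h2 : (1-q+y)*p - (1+γ-2*q)*q - (β-γ-p+y-1)*y = 0)
    (h3 : S = 1 + (1+p-q)*p + (β-γ-p+y-1)*q + (α-2*β+1+2*q)*y)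
    (h4 : -y*α + (1-q+y)*β - (1+p-q)*p = 1)
    (h7 : -y*β + (1-q+y)*γ - (1+p-q)*q = 0)
    (h8 : (1-q+y)*β - (1+γ-2*q)*γ - (β-γ-p+y-1)*q = 1) :
    256 * y^8 * (
      (1 + y + 52*y^2 + 60*y^3 + 787*y^4 + 871*y^5 + 5731*y^6 + 8188*y^7 + 21690*y^8
        + 35452*y^9 + 53179*y^10 + 63508*y^11 + 65208*y^12 + 53304*y^13 + 34304*y^14 + 10240*y^15)
      + (y - 5*y^2 - 115*y^3 - 376*y^4 - 511*y^5 - 7823*y^6 - 4575*y^7 - 37272*y^8 - 50388*y^9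
        - 84400*y^10 - 79736*y^11 - 69312*y^12 - 38912*y^13 - 16384*y^14) * S
      + (-1 - 45*y^2 - 3*y^3 - 1314*y^4 + 315*y^5 - 5483*y^6 - 10146*y^7 + 11385*y^8 + 11576*y^9
        + 39360*y^10 + 18432*y^11 + 16384*y^12) * S^2
      + (162*y^3 - 702*y^5 + 7938*y^6 + 3888*y^7 + 6912*y^8) * S^3
      + 729*y^4 * S^4) = 0 := by
  have hp : 2*y*p = -y + (1+2*y)*q - q^2 := by linear_combination -h1
  have hγ : γ = p + q + 2*q*y - y^2 := by linear_combination h7 - h2 + hp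
  have hγ2 : 2*y*γ = (-y - 2*y^3) + (1 + 4*y + 4*y^2)*q - q^2 := by
    rw [hγ]; linear_combination hp
  have hβ2 : 2*y^2*β = (-y - y^2 - 2*y^3 - 2*y^4) + (1 + 5*y + 8*y^2 + 6*y^3)*q
      + (-3 - 5*y - 4*y^2)*q^2 + 2*q^3 := by
    linear_combination -2*y*h7 + (1-q+y)*hγ2 - q*hp
  have hα4 : 4*y^3*α = (-2*y - 7*y^2 - 6*y^3 - 8*y^4 - 4*y^5)
      + (2 + 14*y + 26*y^2 + 32*y^3 + 16*y^4)*q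
      + (-9 - 28*y - 34*y^2 - 20*y^3)*q^2
      + (12 + 16*y + 8*y^2)*q^3 + (-5)*q^4 := by
    linear_combination -4*y^2*h4 + 2*(1-q+y)*hβ2
      - (2*y*(1-q) + 2*y*p + (-y + (1+2*y)*q - q^2))*hp
  have hG : (-2*y^1 - 7*y^2 - 6*y^3 - 8*y^4 - 4*y^5 - 4*y^6)
    + (2 + 16*y^1 + 26*y^2 + 36*y^3 + 24*y^4 + 16*y^5)*q^1
    + (-11 - 36*y^1 - 46*y^2 - 44*y^3 - 16*y^4)*q^2
    + (18 + 24*y^1 + 24*y^2)*q^3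
    + (-9)*q^4 = 0 := by
    linear_combination 4*y^2*h8 - (2*(1-q+y) - 2*q)*hβ2
      + (2*y*(1-2*q) - 2*y*q + 2*y*γ + ((-y - 2*y^3) + (1 + 4*y + 4*y^2)*q - q^2))*hγ2
      - 2*y*q*hp
  have hS : 4*y^2*S = 2*((-1*y^1 + 1*y^3 + 2*y^5)
    + (1 + 4*y^1 + 3*y^2 + 4*y^3 - 4*y^4)*q^1
    + (-3 - 4*y^1 - 5*y^2)*q^2
    + (2)*q^3) := by
    linear_combination 4*y^2*h3 + (2*y*(1-q) + 2*y*p + (-y + (1+2*y)*q - q^2) - 2*y*q)*hp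
      + (2*q - 4*y)*hβ2 - 2*y*q*hγ2 + hα4
  have e1 : 256 * y^8 * (
      (1 + y + 52*y^2 + 60*y^3 + 787*y^4 + 871*y^5 + 5731*y^6 + 8188*y^7 + 21690*y^8
        + 35452*y^9 + 53179*y^10 + 63508*y^11 + 65208*y^12 + 53304*y^13 + 34304*y^14 + 10240*y^15) + (y - 5*y^2 - 115*y^3 - 376*y^4 - 511*y^5 - 7823*y^6 - 4575*y^7 - 37272*y^8 - 50388*y^9
        - 84400*y^10 - 79736*y^11 - 69312*y^12 - 38912*y^13 - 16384*y^14) * S + (-1 - 45*y^2 - 3*y^3 - 1314*y^4 + 315*y^5 - 5483*y^6 - 10146*y^7 + 11385*y^8 + 11576*y^9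
        + 39360*y^10 + 18432*y^11 + 16384*y^12) * S^2 + (162*y^3 - 702*y^5 + 7938*y^6 + 3888*y^7 + 6912*y^8) * S^3 + 729*y^4 * S^4)
    = (1 + y + 52*y^2 + 60*y^3 + 787*y^4 + 871*y^5 + 5731*y^6 + 8188*y^7 + 21690*y^8
        + 35452*y^9 + 53179*y^10 + 63508*y^11 + 65208*y^12 + 53304*y^13 + 34304*y^14 + 10240*y^15)*(4*y^2)^4 + (y - 5*y^2 - 115*y^3 - 376*y^4 - 511*y^5 - 7823*y^6 - 4575*y^7 - 37272*y^8 - 50388*y^9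
        - 84400*y^10 - 79736*y^11 - 69312*y^12 - 38912*y^13 - 16384*y^14)*(4*y^2)^3*(4*y^2*S) + (-1 - 45*y^2 - 3*y^3 - 1314*y^4 + 315*y^5 - 5483*y^6 - 10146*y^7 + 11385*y^8 + 11576*y^9
        + 39360*y^10 + 18432*y^11 + 16384*y^12)*(4*y^2)^2*(4*y^2*S)^2
      + (162*y^3 - 702*y^5 + 7938*y^6 + 3888*y^7 + 6912*y^8)*(4*y^2)*(4*y^2*S)^3 + 729*y^4*(4*y^2*S)^4 := by ring
  rw [e1, hS]
  linear_combination 16 * ((2*y^5 - 7*y^6 - 102*y^7 + 348*y^8 + 944*y^9 + 1402*y^10 - 5116*y^11 - 22652*y^12 - 42030*y^13 - 55831*y^14 - 7134*y^15 + 19224*y^16 + 99132*y^17 + 15580*y^18 + 29696*y^19 - 65536*y^20)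
    + (-2*y^4 + 654*y^6 + 356*y^7 - 4384*y^8 - 18224*y^9 - 40504*y^10 - 15704*y^11 + 40138*y^12 + 216512*y^13 + 216874*y^14 + 236820*y^15 - 93416*y^16 - 102640*y^17 - 206848*y^18)*q^1
    + (1*y^4 - 924*y^5 - 5750*y^6 - 4236*y^7 + 10634*y^8 + 87416*y^9 + 157596*y^10 + 189176*y^11 + 16269*y^12 - 234652*y^13 - 398782*y^14 - 337068*y^15 - 114576*y^16)*q^2
    + (362*y^4 + 7112*y^5 + 23168*y^6 + 30752*y^7 - 764*y^8 - 152944*y^9 - 271080*y^10 - 389216*y^11 - 152926*y^12 - 52888*y^13 + 144344*y^14)*q^3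
    + (-2377*y^4 - 21840*y^5 - 51364*y^6 - 83888*y^7 - 32222*y^8 + 80240*y^9 + 196236*y^10 + 192272*y^11 + 79199*y^12)*q^4
    + (6264*y^4 + 32928*y^5 + 63096*y^6 + 95232*y^7 + 38664*y^8 + 7200*y^9 - 54168*y^10)*q^5
    + (-8136*y^4 - 24192*y^5 - 39312*y^6 - 38016*y^7 - 10584*y^8)*q^6
    + (5184*y^4 + 6912*y^5 + 9504*y^6)*q^7
    + (-1296*y^4)*q^8) * hG

theorem alg_main {R : Type*} [CommRing R] [IsDomain R] (x S : R) (P A : ℕ → ℕ → R)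
    (hx : x ≠ 0) (hS0 : S ≠ 0) (h256 : (256 : R) ≠ 0)
    (hsym : ∀ k m, P k m = P m k)
    (hA00 : A 0 0 = x) (hA0 : ∀ l, A 0 (l+1) = 0) (hA0' : ∀ l, A (l+1) 0 = 0)
    (hA11 : A 1 1 = P 0 0)
    (hA : ∀ k m, k ≠ 0 ∨ m ≠ 0 → A (k+1) (m+1) = P k m - A k m)
    (hE : ∀ k m, P k m = A k m
      + ∑ l ∈ Finset.range 4, A k l * ∑ t ∈ Finset.range (4 - l), P t m)
    (hS : S = 1 + x * (1 + ∑ k ∈ Finset.range 4, ∑ m ∈ Finset.range 4, P k m)) :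
    (1 + (x*S) + 52*(x*S)^2 + 60*(x*S)^3 + 787*(x*S)^4 + 871*(x*S)^5 + 5731*(x*S)^6 + 8188*(x*S)^7
        + 21690*(x*S)^8
        + 35452*(x*S)^9 + 53179*(x*S)^10 + 63508*(x*S)^11 + 65208*(x*S)^12 + 53304*(x*S)^13
        + 34304*(x*S)^14 + 10240*(x*S)^15)
      + ((x*S) - 5*(x*S)^2 - 115*(x*S)^3 - 376*(x*S)^4 - 511*(x*S)^5 - 7823*(x*S)^6 - 4575*(x*S)^7 - 37272*(x*S)^8 - 50388*(x*S)^9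
        - 84400*(x*S)^10 - 79736*(x*S)^11 - 69312*(x*S)^12 - 38912*(x*S)^13 - 16384*(x*S)^14) * S
      + (-1 - 45*(x*S)^2 - 3*(x*S)^3 - 1314*(x*S)^4 + 315*(x*S)^5 - 5483*(x*S)^6 - 10146*(x*S)^7 + 11385*(x*S)^8 + 11576*(x*S)^9
        + 39360*(x*S)^10 + 18432*(x*S)^11 + 16384*(x*S)^12) * S^2
      + (162*(x*S)^3 - 702*(x*S)^5 + 7938*(x*S)^6 + 3888*(x*S)^7 + 6912*(x*S)^8) * S^3
      + 729*(x*S)^4 * S^4 = 0 := by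
  have hA12 : A 1 2 = P 0 1 := by rw [hA 0 1 (by simp), hA0]; ring
  have hA13 : A 1 3 = P 0 2 := by rw [hA 0 2 (by simp), hA0]; ring
  have hA21 : A 2 1 = P 0 1 := by rw [hA 1 0 (by simp), hA0', hsym 1 0]; ring
  have hA31 : A 3 1 = P 0 2 := by rw [hA 2 0 (by simp), hA0', hsym 2 0]; ring
  have hA22 : A 2 2 = P 1 1 - P 0 0 := by rw [hA 1 1 (by simp), hA11]
  have hA23 : A 2 3 = P 1 2 - P 0 1 := by rw [hA 1 2 (by simp), hA12]
  have hA32 : A 3 2 = P 1 2 - P 0 1 := by rw [hA 2 1 (by simp), hA21, hsym 2 1]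
  have hA33 : A 3 3 = P 2 2 - (P 1 1 - P 0 0) := by rw [hA 2 2 (by simp), hA22]
  have s10 := hsym 1 0
  have s20 := hsym 2 0
  have s30 := hsym 3 0
  have s21 := hsym 2 1
  have s31 := hsym 3 1
  have s32 := hsym 3 2
  have E00 := hE 0 0
  have E01 := hE 0 1
  have E02 := hE 0 2
  have E03 := hE 0 3
  have E10 := hE 1 0
  have E11 := hE 1 1
  have E12 := hE 1 2
  have E20 := hE 2 0
  have E21 := hE 2 1
  have E30 := hE 3 0
  have a01 := hA0 0
  have a02 := hA0 1
  have a03 := hA0 2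
  have b01 := hA0' 0
  have b02 := hA0' 1
  have b03 := hA0' 2
  norm_num at a01 a02 a03 b01 b02 b03
  simp only [Finset.sum_range_succ, Finset.sum_range_zero, zero_add, Nat.sub_zero, Nat.reduceSub,
    hA00, a01, a02, a03, b01, b02, b03, hA11, hA12, hA13, hA21, hA22, hA23, hA31, hA32, hA33,
    s10, s20, s30, s21, s31, s32] at E00 E01 E02 E03 E10 E11 E12 E20 E21 E30 hS
  have hy : x * S = P 0 0 := by
    linear_combination x * hS - E00 - x * E00 - x * E01 - x * E02 - x * E03
  have hS3 : S = 1 + P 0 0 + P 0 1 + P 0 2 + P 0 3 := by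
    linear_combination hS - E00 - E01 - E02 - E03
  have key := alg_elim S (P 0 0) (P 0 0 + P 0 1 + P 0 2) (P 0 0 + P 0 1)
    (1 + P 0 0 + P 1 1 + P 2 2 + 2 * P 0 1 + 2 * P 0 2 + 2 * P 1 2)
    (1 + P 0 0 + P 0 1 + P 0 1 + P 1 1 + P 0 2 + P 1 2)
    (P 0 0 + 2 * P 0 1 + P 1 1)
    (by linear_combination E10)
    (by linear_combination E20)
    (by linear_combination hS3 + E30)
    (by linear_combination E10 + E11 + E12)
    (by linear_combination E10 + E11)
    (by linear_combination E20 + E21)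
  rw [← hy] at key
  rcases mul_eq_zero.mp key with h | h
  · exfalso
    have : x * S ≠ 0 := mul_ne_zero hx hS0
    rcases mul_eq_zero.mp h with h | h
    · exact h256 h
    · exact this (pow_eq_zero_iff (by norm_num) |>.mp h)
  · exact h

/-- Degree of a vertex. -/
def dg (S : Finset (ℕ × ℕ)) (v : ℕ) : ℕ := (S.filter fun p => p.1 = v ∨ p.2 = v).card

/-- Noncrossing arc diagrams on `[a,b]` with interior degrees at most `3`. -/
def NC (a b : ℕ) (S : Finset (ℕ × ℕ)) : Prop :=
  (∀ p ∈ S, a ≤ p.1 ∧ p.1 < p.2 ∧ p.2 ≤ b) ∧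
  (∀ p ∈ S, ∀ q ∈ S, ¬ (p.1 < q.1 ∧ q.1 < p.2 ∧ p.2 < q.2)) ∧
  (∀ v : ℕ, a < v → v < b → dg S v ≤ 3)

open Classical in
/-- Diagrams with prescribed end degrees. -/
noncomputable def Fam (a b k m : ℕ) : Finset (Finset (ℕ × ℕ)) :=
  ((Finset.Icc a b ×ˢ Finset.Icc a b).powerset).filter
    fun S => NC a b S ∧ dg S a = k ∧ dg S b = m

theorem mem_Fam {a b k m : ℕ} {S : Finset (ℕ × ℕ)} :
    S ∈ Fam a b k m ↔ NC a b S ∧ dg S a = k ∧ dg S b = m := by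
  simp only [Fam, Finset.mem_filter, Finset.mem_powerset]
  constructor
  · exact fun h => h.2
  · refine fun h => ⟨fun p hp => ?_, h⟩
    have := h.1.1 p hp
    simp only [Finset.mem_product, Finset.mem_Icc]
    omega

theorem dg_eq_zero {S : Finset (ℕ × ℕ)} {v : ℕ} (h : ∀ p ∈ S, ¬ (p.1 = v ∨ p.2 = v)) :
    dg S v = 0 := by
  unfold dg
  rw [Finset.card_eq_zero, Finset.filter_eq_empty_iff]
  exact fun p hp => h p hp

theorem dg_mono {S T : Finset (ℕ × ℕ)} (h : S ⊆ T) (v : ℕ) : dg S v ≤ dg T v :=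
  Finset.card_le_card (Finset.filter_subset_filter _ h)

theorem dg_union {S T : Finset (ℕ × ℕ)} (h : Disjoint S T) (v : ℕ) :
    dg (S ∪ T) v = dg S v + dg T v := by
  unfold dg
  rw [Finset.filter_union, Finset.card_union_of_disjoint]
  exact Finset.disjoint_filter_filter h

theorem dg_pos {S : Finset (ℕ × ℕ)} {p : ℕ × ℕ} (hp : p ∈ S) {v : ℕ} (h : p.1 = v ∨ p.2 = v) :
    0 < dg S v :=
  Finset.card_pos.mpr ⟨p, Finset.mem_filter.mpr ⟨hp, h⟩⟩

theorem dg_image {S : Finset (ℕ × ℕ)} (φ : ℕ × ℕ → ℕ × ℕ) (hφ : Set.InjOn φ S) {v w : ℕ}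
    (h : ∀ p ∈ S, ((φ p).1 = w ∨ (φ p).2 = w) ↔ (p.1 = v ∨ p.2 = v)) :
    dg (S.image φ) w = dg S v := by
  unfold dg
  rw [Finset.filter_image, Finset.card_image_of_injOn]
  · congr 1
    exact Finset.filter_congr h
  · exact hφ.mono (by intro x hx; exact Finset.mem_coe.mpr (Finset.mem_filter.mp hx).1)

theorem dg_empty (v : ℕ) : dg ∅ v = 0 := by simp [dg]

theorem image_inj_of_injOn {U : Finset (ℕ × ℕ)} {φ : ℕ × ℕ → ℕ × ℕ}
    (hφ : Set.InjOn φ U) {S T : Finset (ℕ × ℕ)} (hS : S ⊆ U) (hT : T ⊆ U)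
    (h : S.image φ = T.image φ) : S = T := by
  have := (hφ.image_eq_image_iff (s₁ := (S : Set (ℕ × ℕ))) (s₂ := T)
    (by exact_mod_cast hS) (by exact_mod_cast hT)).mp (by rw [← Finset.coe_image, h, Finset.coe_image])
  exact_mod_cast this

theorem Fam_sub {a b k m : ℕ} {S : Finset (ℕ × ℕ)} (h : S ∈ Fam a b k m) :
    S ⊆ (Finset.Icc a b ×ˢ Finset.Icc a b) := by
  simp only [Fam, Finset.mem_filter, Finset.mem_powerset] at h
  exact h.1

theorem Fam_le_of_mono {a b a' b' : ℕ} (hab : a ≤ b) (σ : ℕ → ℕ)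
    (hσ : StrictMonoOn σ (Set.Icc a b)) (ha : σ a = a') (hb : σ b = b') (k m : ℕ) :
    (Fam a b k m).card ≤ (Fam a' b' k m).card := by
  have hinj : Set.InjOn (fun p : ℕ × ℕ => (σ p.1, σ p.2))
      (Finset.Icc a b ×ˢ Finset.Icc a b : Finset (ℕ × ℕ)) := by
    rintro ⟨i, j⟩ hp ⟨i', j'⟩ hq h
    simp only [Finset.coe_product, Finset.coe_Icc, Set.mem_prod] at hp hq
    simp only [Prod.mk.injEq] at h
    rw [hσ.injOn hp.1 hq.1 h.1, hσ.injOn hp.2 hq.2 h.2]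
  apply Finset.card_le_card_of_injOn (fun S => S.image fun p => (σ p.1, σ p.2))
  · intro S hS
    have hsub := Fam_sub hS
    rw [Finset.mem_coe, mem_Fam] at hS ⊢
    obtain ⟨⟨h1, h2, h3⟩, h4, h5⟩ := hS
    have m1 : ∀ p ∈ S, p.1 ∈ Set.Icc a b ∧ p.2 ∈ Set.Icc a b := fun p hp => by
      have := h1 p hp
      simp only [Set.mem_Icc]; omega
    have hd : ∀ v ∈ Set.Icc a b, dg (S.image fun p => (σ p.1, σ p.2)) (σ v) = dg S v := by
      intro v hv
      apply dg_image _ (hinj.mono (by exact_mod_cast hsub))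
      intro p hp
      simp only [hσ.injOn.eq_iff (m1 p hp).1 hv, hσ.injOn.eq_iff (m1 p hp).2 hv]
    have ma : a ∈ Set.Icc a b := ⟨le_refl _, hab⟩
    have mb : b ∈ Set.Icc a b := ⟨hab, le_refl _⟩
    refine ⟨⟨?_, ?_, ?_⟩, ?_, ?_⟩
    · intro p hp
      obtain ⟨q, hq, rfl⟩ := Finset.mem_image.mp hp
      have := m1 q hq
      refine ⟨?_, hσ this.1 this.2 (h1 q hq).2.1, ?_⟩
      · rw [← ha]; exact hσ.monotoneOn ma this.1 this.1.1
      · rw [← hb]; exact hσ.monotoneOn this.2 mb this.2.2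
    · intro p hp q hq
      obtain ⟨p, hp', rfl⟩ := Finset.mem_image.mp hp; replace hp := hp'; clear hp'
      obtain ⟨q, hq', rfl⟩ := Finset.mem_image.mp hq; replace hq := hq'; clear hq'
      have hp' := m1 p hp
      have hq' := m1 q hq
      simp only [hσ.lt_iff_lt hp'.1 hq'.1, hσ.lt_iff_lt hq'.1 hp'.2, hσ.lt_iff_lt hp'.2 hq'.2]
      exact h2 p hp q hq
    · intro w hw1 hw2
      by_cases hex : ∃ v ∈ Set.Icc a b, σ v = w
      · obtain ⟨v, hv, rfl⟩ := hex
        rw [hd v hv]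
        apply h3 v
        · rw [← ha] at hw1; exact (hσ.lt_iff_lt ma hv).mp hw1
        · rw [← hb] at hw2; exact (hσ.lt_iff_lt hv mb).mp hw2
      · rw [dg_eq_zero]
        · omega
        · intro p hp hh
          obtain ⟨p, hp', rfl⟩ := Finset.mem_image.mp hp; replace hp := hp'; clear hp'
          rcases hh with hh | hh
          · exact hex ⟨_, (m1 p hp).1, hh⟩
          · exact hex ⟨_, (m1 p hp).2, hh⟩
    · rw [← ha, hd a ma, h4]
    · rw [← hb, hd b mb, h5]
  · intro S hS T hT h
    exact image_inj_of_injOn hinj (Fam_sub hS) (Fam_sub hT) h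

theorem Fam_shift {a b : ℕ} (hab : a ≤ b) (k m : ℕ) :
    (Fam a b k m).card = (Fam 0 (b - a) k m).card := by
  apply le_antisymm
  · apply Fam_le_of_mono hab (fun v => v - a)
    · intro x hx y hy hxy
      simp only [Set.mem_Icc] at hx hy ⊢
      omega
    · simp
    · simp
  · apply Fam_le_of_mono (Nat.zero_le _) (fun v => v + a)
    · intro x hx y hy hxy
      simp only [Set.mem_Icc] at hx hy ⊢
      omega
    · simp
    · omega

theorem Fam_refl_le (n k m : ℕ) : (Fam 0 n k m).card ≤ (Fam 0 n m k).card := by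
  have hinj : Set.InjOn (fun p : ℕ × ℕ => (n - p.2, n - p.1))
      (Finset.Icc 0 n ×ˢ Finset.Icc 0 n : Finset (ℕ × ℕ)) := by
    rintro ⟨i, j⟩ hp ⟨i', j'⟩ hq h
    simp only [Finset.coe_product, Finset.coe_Icc, Set.mem_prod, Set.mem_Icc] at hp hq
    simp only [Prod.mk.injEq] at h ⊢
    omega
  apply Finset.card_le_card_of_injOn (fun S => S.image fun p => (n - p.2, n - p.1))
  · intro S hS
    have hsub := Fam_sub hS
    rw [Finset.mem_coe, mem_Fam] at hS ⊢
    obtain ⟨⟨h1, h2, h3⟩, h4, h5⟩ := hS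
    have hd : ∀ v ≤ n, dg (S.image fun p => (n - p.2, n - p.1)) v = dg S (n - v) := by
      intro v hv
      apply dg_image _ (hinj.mono (by exact_mod_cast hsub))
      intro p hp
      have := h1 p hp
      simp only
      omega
    refine ⟨⟨?_, ?_, ?_⟩, ?_, ?_⟩
    · intro p hp
      obtain ⟨q, hq, rfl⟩ := Finset.mem_image.mp hp
      have := h1 q hq
      simp only
      omega
    · intro p hp q hq
      obtain ⟨p, hp', rfl⟩ := Finset.mem_image.mp hp; replace hp := hp'; clear hp'
      obtain ⟨q, hq', rfl⟩ := Finset.mem_image.mp hq; replace hq := hq'; clear hq'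
      have := h1 p hp
      have := h1 q hq
      have := h2 q hq p hp
      simp only
      omega
    · intro w hw1 hw2
      rw [hd w hw2.le]
      apply h3 <;> omega
    · rw [hd 0 (Nat.zero_le _)]; simpa using h5
    · rw [hd n le_rfl]; simpa using h4
  · intro S hS T hT h
    exact image_inj_of_injOn hinj (Fam_sub hS) (Fam_sub hT) h

/-- A piece: either the outer arc is present, or it is an empty gap of length one. -/
def IsPc (a b : ℕ) (S : Finset (ℕ × ℕ)) : Prop := (a, b) ∈ S ∨ (b = a + 1 ∧ S = ∅)

open Classical in
/-- The pieces in a family. -/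
noncomputable def PFam (n k m : ℕ) : Finset (Finset (ℕ × ℕ)) := (Fam 0 n k m).filter (IsPc 0 n)

theorem mem_PFam {n k m : ℕ} {S : Finset (ℕ × ℕ)} :
    S ∈ PFam n k m ↔ S ∈ Fam 0 n k m ∧ IsPc 0 n S := by
  simp only [PFam, Finset.mem_filter]

theorem PFam_zero_right {n k m : ℕ} (h : k = 0 ∧ m ≠ 0 ∨ k ≠ 0 ∧ m = 0) : PFam n k m = ∅ := by
  rw [Finset.eq_empty_iff_forall_notMem]
  intro S hS
  rw [mem_PFam, mem_Fam] at hS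
  obtain ⟨⟨_, h1, h2⟩, h3 | ⟨_, rfl⟩⟩ := hS
  · have := dg_pos h3 (v := 0) (by simp)
    have := dg_pos h3 (v := n) (by simp)
    omega
  · rw [dg_empty] at h1 h2; omega

theorem PFam_zero_zero (n : ℕ) : (PFam n 0 0).card = if n = 1 then 1 else 0 := by
  split_ifs with hn
  · subst hn
    rw [Finset.card_eq_one]
    refine ⟨∅, ?_⟩
    ext S
    rw [Finset.mem_singleton, mem_PFam, mem_Fam]
    constructor
    · rintro ⟨⟨_, h1, h2⟩, h3 | ⟨_, rfl⟩⟩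
      · have := dg_pos h3 (v := 0) (by simp)
        omega
      · rfl
    · rintro rfl
      refine ⟨⟨⟨by simp, by simp, fun v _ _ => by simp [dg_empty]⟩, dg_empty _, dg_empty _⟩, ?_⟩
      exact Or.inr ⟨rfl, rfl⟩
  · rw [Finset.card_eq_zero, Finset.eq_empty_iff_forall_notMem]
    intro S hS
    rw [mem_PFam, mem_Fam] at hS
    obtain ⟨⟨_, h1, h2⟩, h3 | ⟨h3, rfl⟩⟩ := hS
    · have := dg_pos h3 (v := 0) (by simp)
      omega
    · omega

theorem dg_insert {S : Finset (ℕ × ℕ)} {p : ℕ × ℕ} (hp : p ∉ S) (v : ℕ) :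
    dg (insert p S) v = dg S v + if p.1 = v ∨ p.2 = v then 1 else 0 := by
  unfold dg
  rw [Finset.filter_insert]
  split_ifs
  · rw [Finset.card_insert_of_notMem]
    simp [hp]
  · simp

open Classical in
theorem PFam_succ {n : ℕ} (hn : 0 < n) (k m : ℕ) :
    (PFam n (k+1) (m+1)).card = ((Fam 0 n k m).filter fun S => (0, n) ∉ S).card := by
  symm
  apply Finset.card_nbij' (fun S => insert (0, n) S) (fun S => S.erase (0, n))
  · intro S hS
    simp only [Finset.coe_filter, Set.mem_ofPred_eq, mem_Fam] at hS
    rw [Finset.mem_coe, mem_PFam, mem_Fam]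
    obtain ⟨⟨⟨h1, h2, h3⟩, h4, h5⟩, h6⟩ := hS
    refine ⟨⟨⟨?_, ?_, ?_⟩, ?_, ?_⟩, Or.inl (Finset.mem_insert_self _ _)⟩
    · intro p hp
      rcases Finset.mem_insert.mp hp with rfl | hp
      · simp only; omega
      · exact h1 p hp
    · intro p hp q hq
      rcases Finset.mem_insert.mp hp with rfl | hp <;> rcases Finset.mem_insert.mp hq with rfl | hq
      · simp
      · have := h1 q hq
        simp only; omega
      · have := h1 p hp
        simp only; omega
      · exact h2 p hp q hq
    · intro v hv1 hv2
      rw [dg_insert h6, if_neg (by simp only; omega)]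
      exact h3 v hv1 hv2
    · rw [dg_insert h6, if_pos (by simp), h4]
    · rw [dg_insert h6, if_pos (by simp), h5]
  · intro S hS
    rw [Finset.mem_coe, mem_PFam, mem_Fam] at hS
    simp only [Finset.coe_filter, Set.mem_ofPred_eq, mem_Fam]
    obtain ⟨⟨⟨h1, h2, h3⟩, h4, h5⟩, h6⟩ := hS
    have h7 : (0, n) ∈ S := by
      rcases h6 with h6 | ⟨_, rfl⟩
      · exact h6
      · rw [dg_empty] at h4; omega
    have hne : (0, n) ∉ S.erase (0, n) := Finset.notMem_erase _ _
    have hd := fun v => dg_insert hne v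
    rw [Finset.insert_erase h7] at hd
    refine ⟨⟨⟨?_, ?_, ?_⟩, ?_, ?_⟩, hne⟩
    · exact fun p hp => h1 p (Finset.mem_of_mem_erase hp)
    · exact fun p hp q hq => h2 p (Finset.mem_of_mem_erase hp) q (Finset.mem_of_mem_erase hq)
    · exact fun v hv1 hv2 => (dg_mono (Finset.erase_subset _ _) v).trans (h3 v hv1 hv2)
    · have := hd 0
      rw [if_pos (by simp)] at this
      omega
    · have := hd n
      rw [if_pos (by simp)] at this
      omega
  · intro S hS
    simp only [Finset.coe_filter, Set.mem_ofPred_eq] at hS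
    exact Finset.erase_insert hS.2
  · intro S hS
    rw [Finset.mem_coe, mem_PFam, mem_Fam] at hS
    obtain ⟨⟨⟨h1, h2, h3⟩, h4, h5⟩, h6⟩ := hS
    have h7 : (0, n) ∈ S := by
      rcases h6 with h6 | ⟨_, rfl⟩
      · exact h6
      · rw [dg_empty] at h4; omega
    exact Finset.insert_erase h7

theorem PFam_one_one {n : ℕ} (hn : 0 < n) : (PFam n 1 1).card = (Fam 0 n 0 0).card := by
  classical
  rw [PFam_succ hn 0 0, Finset.filter_true_of_mem]
  intro S hS h
  rw [mem_Fam] at hS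
  have := dg_pos h (v := 0) (by simp)
  omega

theorem PFam_succ' {n : ℕ} (hn : 0 < n) {k m : ℕ} (h : k ≠ 0 ∨ m ≠ 0) :
    (PFam n (k+1) (m+1)).card + (PFam n k m).card = (Fam 0 n k m).card := by
  classical
  rw [PFam_succ hn, ← Finset.card_filter_add_card_filter_not (s := Fam 0 n k m) (fun S => (0, n) ∉ S)]
  congr 2
  ext S
  rw [mem_PFam, Finset.mem_filter]
  refine and_congr_right fun hS => ?_
  rw [not_not]
  constructor
  · rintro (h | ⟨_, rfl⟩)
    · exact h
    · rw [mem_Fam, dg_empty, dg_empty] at hS; omega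
  · exact Or.inl

theorem union_mem {n i k l t m : ℕ} (hi : 0 < i) (hin : i < n) (hlt : l + t ≤ 3)
    {S T : Finset (ℕ × ℕ)} (hS : S ∈ Fam 0 i k l) (hT : T ∈ Fam i n t m) :
    Disjoint S T ∧ S ∪ T ∈ Fam 0 n k m := by
  rw [mem_Fam] at hS hT
  obtain ⟨⟨s1, s2, s3⟩, s4, s5⟩ := hS
  obtain ⟨⟨t1, t2, t3⟩, t4, t5⟩ := hT
  have hdis : Disjoint S T := by
    rw [Finset.disjoint_left]
    intro p hp hq
    have := s1 p hp
    have := t1 p hq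
    omega
  refine ⟨hdis, ?_⟩
  have zS : ∀ v, i < v → dg S v = 0 := fun v hv => dg_eq_zero fun p hp => by
    have := s1 p hp
    omega
  have zT : ∀ v, v < i → dg T v = 0 := fun v hv => dg_eq_zero fun p hp => by
    have := t1 p hp
    omega
  rw [mem_Fam]
  refine ⟨⟨?_, ?_, ?_⟩, ?_, ?_⟩
  · intro p hp
    rcases Finset.mem_union.mp hp with hp | hp
    · have := s1 p hp
      omega
    · have := t1 p hp
      omega
  · intro p hp q hq
    rcases Finset.mem_union.mp hp with hp | hp <;> rcases Finset.mem_union.mp hq with hq | hq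
    · exact s2 p hp q hq
    · have := s1 p hp
      have := t1 q hq
      omega
    · have := t1 p hp
      have := s1 q hq
      omega
    · exact t2 p hp q hq
  · intro v hv1 hv2
    rw [dg_union hdis]
    rcases lt_trichotomy v i with h | rfl | h
    · rw [zT v h]; exact s3 v hv1 h
    · omega
    · rw [zS v h, zero_add]; exact t3 v h hv2
  · rw [dg_union hdis, zT 0 hi, s4, add_zero]
  · rw [dg_union hdis, zS n hin, t5, zero_add]

theorem exists_cut {n : ℕ} (hn : 0 < n) {S : Finset (ℕ × ℕ)} (hS : NC 0 n S) (hp : ¬ IsPc 0 n S) :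
    ∃ i, 0 < i ∧ i < n ∧ (∀ p ∈ S, ¬ (p.1 < i ∧ i < p.2)) ∧
      IsPc 0 i (S.filter fun p => p.2 ≤ i) := by
  obtain ⟨h1, h2, h3⟩ := hS
  by_cases hne : (S.filter fun p => p.1 = 0).Nonempty
  · obtain ⟨⟨z, i⟩, hi, hmax⟩ := Finset.exists_max_image _ (fun p : ℕ × ℕ => p.2) hne
    rw [Finset.mem_filter] at hi
    obtain ⟨hiS, rfl⟩ := hi
    have hi0 := h1 _ hiS
    simp only at hi0
    have hin : i ≠ n := by
      rintro rfl
      exact hp (Or.inl hiS)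
    refine ⟨i, hi0.2.1, by omega, ?_, Or.inl ?_⟩
    · rintro q hq ⟨ha, hb⟩
      by_cases hq0 : q.1 = 0
      · have := hmax q (Finset.mem_filter.mpr ⟨hq, hq0⟩)
        simp only at this
        omega
      · exact h2 _ hiS q hq ⟨by simp only; omega, ha, hb⟩
    · simp [hiS]
  · have hno : ∀ p ∈ S, p.1 ≠ 0 := fun p hp h0 => hne ⟨p, Finset.mem_filter.mpr ⟨hp, h0⟩⟩
    have hn1 : n ≠ 1 := by
      rintro rfl
      apply hp
      refine Or.inr ⟨rfl, ?_⟩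
      rw [Finset.eq_empty_iff_forall_notMem]
      intro p hp
      have := h1 p hp
      have := hno p hp
      omega
    refine ⟨1, one_pos, by omega, ?_, Or.inr ⟨rfl, ?_⟩⟩
    · intro p hp
      have := hno p hp
      omega
    · rw [Finset.filter_eq_empty_iff]
      intro p hp
      have := h1 p hp
      have := hno p hp
      omega

theorem cut_unique {n i i' k k' l l' t m : ℕ} (hi : 0 < i) (hii : i < i')
    {S T S' T' : Finset (ℕ × ℕ)} (hS : S ∈ Fam 0 i k l) (hT : T ∈ Fam i n t m)
    (hS' : S' ∈ PFam i' k' l') (h : S ∪ T = S' ∪ T') : False := by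
  rw [mem_Fam] at hS hT
  rw [mem_PFam] at hS'
  rcases hS'.2 with h1 | ⟨h1, _⟩
  · have : (0, i') ∈ S ∪ T := by rw [h]; exact Finset.mem_union_left _ h1
    rcases Finset.mem_union.mp this with h2 | h2
    · have := hS.1.1 _ h2
      simp only at this
      omega
    · have := hT.1.1 _ h2
      simp only at this
      omega
  · omega

theorem filter_left {n i k l t m : ℕ} {S T : Finset (ℕ × ℕ)} (hS : S ∈ Fam 0 i k l)
    (hT : T ∈ Fam i n t m) : (S ∪ T).filter (fun p => p.2 ≤ i) = S := by
  rw [mem_Fam] at hS hT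
  ext p
  simp only [Finset.mem_filter, Finset.mem_union]
  constructor
  · rintro ⟨h | h, h'⟩
    · exact h
    · have := hT.1.1 p h
      omega
  · exact fun h => ⟨Or.inl h, (hS.1.1 p h).2.2⟩

theorem filter_right {n i k l t m : ℕ} {S T : Finset (ℕ × ℕ)} (hS : S ∈ Fam 0 i k l)
    (hT : T ∈ Fam i n t m) : (S ∪ T).filter (fun p => i ≤ p.1) = T := by
  rw [mem_Fam] at hS hT
  ext p
  simp only [Finset.mem_filter, Finset.mem_union]
  constructor
  · rintro ⟨h | h, h'⟩
    · have := hS.1.1 p h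
      omega
    · exact h
  · exact fun h => ⟨Or.inr h, (hT.1.1 p h).1⟩

/-- Index set of the first piece decomposition. -/
def idx (n : ℕ) : Finset (ℕ × (Σ _ : ℕ, ℕ)) :=
  Finset.Ioo 0 n ×ˢ ((Finset.range 4).sigma fun l => Finset.range (4 - l))

theorem split_mem {n i k m : ℕ} (hi : 0 < i) (hin : i < n)
    {S : Finset (ℕ × ℕ)} (hS : S ∈ Fam 0 n k m) (hc : ∀ p ∈ S, ¬ (p.1 < i ∧ i < p.2)) :
    ∃ l t, l + t ≤ 3 ∧ (S.filter fun p => p.2 ≤ i) ∈ Fam 0 i k l ∧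
      (S.filter fun p => i ≤ p.1) ∈ Fam i n t m ∧
      (S.filter fun p => p.2 ≤ i) ∪ (S.filter fun p => i ≤ p.1) = S := by
  rw [mem_Fam] at hS
  obtain ⟨⟨h1, h2, h3⟩, h4, h5⟩ := hS
  have hU : (S.filter fun p => p.2 ≤ i) ∪ (S.filter fun p => i ≤ p.1) = S := by
    rw [← Finset.filter_or, Finset.filter_true_of_mem]
    intro p hp
    have := hc p hp
    omega
  have hdis : Disjoint (S.filter fun p => p.2 ≤ i) (S.filter fun p => i ≤ p.1) := by
    rw [Finset.disjoint_filter]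
    intro p hp
    have := h1 p hp
    omega
  have hd := fun v => dg_union hdis v
  rw [hU] at hd
  have zS : ∀ v, i < v → dg (S.filter fun p => p.2 ≤ i) v = 0 := fun v hv => dg_eq_zero fun p hp => by
    rw [Finset.mem_filter] at hp
    have := h1 p hp.1
    omega
  have zT : ∀ v, v < i → dg (S.filter fun p => i ≤ p.1) v = 0 := fun v hv => dg_eq_zero fun p hp => by
    rw [Finset.mem_filter] at hp
    have := h1 p hp.1
    omega
  refine ⟨dg (S.filter fun p => p.2 ≤ i) i, dg (S.filter fun p => i ≤ p.1) i, ?_, ?_, ?_, hU⟩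
  · rw [← hd]; exact h3 i hi hin
  · rw [mem_Fam]
    refine ⟨⟨?_, ?_, ?_⟩, ?_, rfl⟩
    · intro p hp
      rw [Finset.mem_filter] at hp
      have := h1 p hp.1
      omega
    · intro p hp q hq
      exact h2 p (Finset.mem_of_mem_filter _ hp) q (Finset.mem_of_mem_filter _ hq)
    · intro v hv1 hv2
      have := hd v
      have := h3 v hv1 (by omega)
      omega
    · have := hd 0
      rw [zT 0 hi] at this
      omega
  · rw [mem_Fam]
    refine ⟨⟨?_, ?_, ?_⟩, rfl, ?_⟩
    · intro p hp
      rw [Finset.mem_filter] at hp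
      have := h1 p hp.1
      omega
    · intro p hp q hq
      exact h2 p (Finset.mem_of_mem_filter _ hp) q (Finset.mem_of_mem_filter _ hq)
    · intro v hv1 hv2
      have := hd v
      have := h3 v (by omega) hv2
      omega
    · have := hd n
      rw [zS n hin] at this
      omega

open Classical in
theorem nonpiece_card {n : ℕ} (hn : 0 < n) (k m : ℕ) :
    ((Fam 0 n k m).filter fun S => ¬ IsPc 0 n S).card =
      ((idx n).sigma fun j => PFam j.1 k j.2.1 ×ˢ Fam j.1 n j.2.2 m).card := by
  symm
  apply Finset.card_bij (fun x _ => x.2.1 ∪ x.2.2)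
  · rintro ⟨⟨i, l, t⟩, S, T⟩ hx
    simp only [idx, Finset.mem_sigma, Finset.mem_product, Finset.mem_Ioo, Finset.mem_range] at hx
    obtain ⟨⟨⟨hi, hin⟩, hl, ht⟩, hS, hT⟩ := hx
    have hS' := (mem_PFam.mp hS).1
    rw [Finset.mem_filter]
    refine ⟨(union_mem hi hin (by omega) hS' hT).2, ?_⟩
    rintro (h | ⟨h, _⟩)
    · rw [mem_Fam] at hS' hT
      rcases Finset.mem_union.mp h with h2 | h2
      · have := hS'.1.1 _ h2
        simp only at this
        omega
      · have := hT.1.1 _ h2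
        simp only at this
        omega
    · omega
  · rintro ⟨⟨i, l, t⟩, S, T⟩ hx ⟨⟨i', l', t'⟩, S', T'⟩ hx' h
    simp only [idx, Finset.mem_sigma, Finset.mem_product, Finset.mem_Ioo, Finset.mem_range] at hx hx'
    obtain ⟨⟨⟨hi, hin⟩, hl, ht⟩, hS, hT⟩ := hx
    obtain ⟨⟨⟨hi', hin'⟩, hl', ht'⟩, hS', hT'⟩ := hx'
    simp only at h
    have fS := (mem_PFam.mp hS).1
    have fS' := (mem_PFam.mp hS').1
    rcases lt_trichotomy i i' with h1 | rfl | h1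
    · exact (cut_unique hi h1 fS hT hS' h).elim
    · have e1 : S = S' := by rw [← filter_left fS hT, h, filter_left fS' hT']
      have e2 : T = T' := by rw [← filter_right fS hT, h, filter_right fS' hT']
      subst e1 e2
      rw [mem_Fam] at fS fS' hT hT'
      obtain rfl : l = l' := by rw [← fS.2.2, ← fS'.2.2]
      obtain rfl : t = t' := by rw [← hT.2.1, ← hT'.2.1]
      rfl
    · exact (cut_unique hi' h1 fS' hT' hS h.symm).elim
  · intro S hS
    rw [Finset.mem_filter] at hS
    obtain ⟨i, hi, hin, hc, hpc⟩ := exists_cut hn (mem_Fam.mp hS.1).1 hS.2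
    obtain ⟨l, t, hlt, hl, hr, hU⟩ := split_mem hi hin hS.1 hc
    refine ⟨⟨⟨i, l, t⟩, _, _⟩, ?_, hU⟩
    simp only [idx, Finset.mem_sigma, Finset.mem_product, Finset.mem_Ioo, Finset.mem_range]
    exact ⟨⟨⟨hi, hin⟩, by omega, by omega⟩, mem_PFam.mpr ⟨hl, hpc⟩, hr⟩

theorem Fam_rec {n : ℕ} (hn : 0 < n) (k m : ℕ) :
    (Fam 0 n k m).card = (PFam n k m).card +
      ∑ i ∈ Finset.Ioo 0 n, ∑ l ∈ Finset.range 4, (PFam i k l).card *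
        ∑ t ∈ Finset.range (4 - l), (Fam 0 (n - i) t m).card := by
  classical
  rw [← Finset.card_filter_add_card_filter_not (s := Fam 0 n k m) (IsPc 0 n)]
  congr 1
  · rw [nonpiece_card hn, Finset.card_sigma, idx, Finset.sum_product]
    refine Finset.sum_congr rfl fun i hi => ?_
    rw [Finset.mem_Ioo] at hi
    rw [Finset.sum_sigma]
    refine Finset.sum_congr rfl fun l _ => ?_
    rw [Finset.mul_sum]
    refine Finset.sum_congr rfl fun t _ => ?_
    rw [Finset.card_product, Fam_shift hi.2.le]

/-- Generating function of diagrams with given end degrees on at least two vertices. -/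
noncomputable def Pgf (k m : ℕ) : PowerSeries ℤ :=
  PowerSeries.mk fun n => if n = 0 then 0 else ((Fam 0 n k m).card : ℤ)

/-- Generating function of pieces with given end degrees. -/
noncomputable def Agf (k m : ℕ) : PowerSeries ℤ :=
  PowerSeries.mk fun n => if n = 0 then 0 else ((PFam n k m).card : ℤ)

theorem Pgf_symm (k m : ℕ) : Pgf k m = Pgf m k := by
  ext n
  simp only [Pgf, PowerSeries.coeff_mk]
  rw [le_antisymm (Fam_refl_le n k m) (Fam_refl_le n m k)]

theorem Agf_zero_zero : Agf 0 0 = PowerSeries.X := by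
  ext n
  simp only [Agf, PowerSeries.coeff_mk, PFam_zero_zero, PowerSeries.coeff_X]
  by_cases h : n = 0
  · simp [h]
  · simp [h]

theorem Agf_zero {k m : ℕ} (h : k = 0 ∧ m ≠ 0 ∨ k ≠ 0 ∧ m = 0) : Agf k m = 0 := by
  ext n
  simp [Agf, PFam_zero_right h]

theorem Agf_one_one : Agf 1 1 = Pgf 0 0 := by
  ext n
  simp only [Agf, Pgf, PowerSeries.coeff_mk]
  split_ifs with h
  · rfl
  · rw [PFam_one_one (Nat.pos_of_ne_zero h)]

theorem Agf_succ {k m : ℕ} (h : k ≠ 0 ∨ m ≠ 0) : Agf (k+1) (m+1) = Pgf k m - Agf k m := by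
  ext n
  simp only [Agf, Pgf, PowerSeries.coeff_mk, map_sub]
  split_ifs with h0
  · rfl
  · rw [← PFam_succ' (Nat.pos_of_ne_zero h0) h]
    push_cast
    ring

theorem Pgf_rec (k m : ℕ) : Pgf k m = Agf k m
      + ∑ l ∈ Finset.range 4, Agf k l * ∑ t ∈ Finset.range (4 - l), Pgf t m := by
  ext n
  by_cases h0 : n = 0
  · subst h0
    simp [Agf, Pgf]
  · rw [map_add, map_sum]
    simp only [PowerSeries.coeff_mul]
    rw [Finset.sum_comm, Finset.Nat.sum_antidiagonal_eq_sum_range_succ_mk]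
    have hsub : Finset.Ioo 0 n ⊆ Finset.range n.succ := by
      intro i hi
      rw [Finset.mem_Ioo] at hi
      rw [Finset.mem_range]
      omega
    rw [← Finset.sum_subset hsub]
    · simp only [Agf, Pgf, PowerSeries.coeff_mk, if_neg h0, map_sum]
      rw [Fam_rec (Nat.pos_of_ne_zero h0)]
      push_cast
      congr 1
      refine Finset.sum_congr rfl fun i hi => ?_
      rw [Finset.mem_Ioo] at hi
      simp only [if_neg (show i ≠ 0 by omega), if_neg (show n - i ≠ 0 by omega)]
    · intro i hi hi'
      rw [Finset.mem_range] at hi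
      rw [Finset.mem_Ioo] at hi'
      apply Finset.sum_eq_zero
      intro l _
      by_cases hi0 : i = 0
      · simp [Agf, hi0]
      · obtain rfl : i = n := by omega
        simp [Pgf]

theorem isStack_iff {n : ℕ} (S : Finset (ℕ × ℕ)) :
    IsStack 1 3 n S ↔ NC 1 n S ∧ dg S 1 ≤ 3 ∧ dg S n ≤ 3 := by
  constructor
  · rintro ⟨⟨h1, h2, h3⟩, _⟩
    exact ⟨⟨h1, h2, fun v _ _ => h3 v⟩, h3 1, h3 n⟩
  · rintro ⟨⟨h1, h2, h3⟩, h4, h5⟩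
    refine ⟨⟨h1, h2, fun v => ?_⟩, fun p hp => ?_⟩
    · change dg S v ≤ 3
      by_cases hv : v = 1
      · rwa [hv]
      by_cases hv' : v = n
      · rwa [hv']
      by_cases hv2 : 1 < v ∧ v < n
      · exact h3 v hv2.1 hv2.2
      · rw [dg_eq_zero]
        · omega
        · intro p hp
          have := h1 p hp
          omega
    · have := h1 p hp
      omega

theorem sCount_small {n : ℕ} (hn : n ≤ 1) : sCount 1 3 n = 1 := by
  unfold sCount
  rw [Set.ncard_eq_one]
  refine ⟨∅, ?_⟩
  ext S
  simp only [Set.mem_ofPred_eq, Set.mem_singleton_iff]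
  constructor
  · rintro ⟨⟨h1, _⟩, _⟩
    rw [Finset.eq_empty_iff_forall_notMem]
    intro p hp
    have := h1 p hp
    omega
  · rintro rfl
    refine ⟨⟨by simp, by simp, by simp⟩, ?_⟩
    intro p hp
    simp at hp

theorem sCount_big (n : ℕ) : sCount 1 3 (n + 2) =
    ∑ k ∈ Finset.range 4, ∑ m ∈ Finset.range 4, (Fam 0 (n + 1) k m).card := by
  classical
  have h : {S : Finset (ℕ × ℕ) | IsStack 1 3 (n + 2) S} =
      (((Finset.range 4 ×ˢ Finset.range 4).biUnion fun x => Fam 1 (n + 2) x.1 x.2 :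
        Finset (Finset (ℕ × ℕ))) : Set (Finset (ℕ × ℕ))) := by
    ext S
    simp only [Set.mem_ofPred_eq, Finset.mem_coe, Finset.mem_biUnion, Finset.mem_product,
      Finset.mem_range, mem_Fam, isStack_iff]
    constructor
    · rintro ⟨h1, h2, h3⟩
      exact ⟨(dg S 1, dg S (n+2)), ⟨by simp only; omega, by simp only; omega⟩, h1, rfl, rfl⟩
    · rintro ⟨x, hx, h1, h2, h3⟩
      exact ⟨h1, by omega, by omega⟩
  unfold sCount
  rw [h, Set.ncard_coe_finset, Finset.card_biUnion, Finset.sum_product]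
  · refine Finset.sum_congr rfl fun k _ => Finset.sum_congr rfl fun m _ => ?_
    rw [Fam_shift (by omega)]
    rfl
  · intro x _ y _ hxy
    change Disjoint (Fam 1 (n + 2) x.1 x.2) (Fam 1 (n + 2) y.1 y.2)
    rw [Finset.disjoint_left]
    intro S hS hS'
    rw [mem_Fam] at hS hS'
    apply hxy
    ext
    · rw [← hS.2.1, ← hS'.2.1]
    · rw [← hS.2.2, ← hS'.2.2]

theorem Sps_eq : Sps 1 3 = 1 + PowerSeries.X *
    (1 + ∑ k ∈ Finset.range 4, ∑ m ∈ Finset.range 4, Pgf k m) := by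
  ext n
  rcases n with _ | _ | n
  · simp [Sps, sCount_small]
  · rw [zero_add, map_add, ← zero_add 1, PowerSeries.coeff_succ_X_mul]
    simp [Sps, sCount_small, Pgf, PowerSeries.coeff_one]
  · rw [map_add, PowerSeries.coeff_succ_X_mul]
    simp [Sps, sCount_big, Pgf, PowerSeries.coeff_one]

theorem stmt17 :
    ∑ k ∈ Finset.range 16, c13 k * (Sps 1 3) ^ k = 0 := by
  have hS0 : Sps 1 3 ≠ 0 := by
    intro h
    have h1 := congrArg (PowerSeries.coeff 0) h
    simp [Sps, sCount_small] at h1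
  have h256 : (256 : PowerSeries ℤ) ≠ 0 := by
    intro h
    have h1 := congrArg PowerSeries.constantCoeff h
    rw [map_ofNat, map_zero] at h1
    norm_num at h1
  have key := alg_main (PowerSeries.X : PowerSeries ℤ) (Sps 1 3) Pgf Agf PowerSeries.X_ne_zero hS0 h256
    Pgf_symm Agf_zero_zero (fun l => Agf_zero (by simp)) (fun l => Agf_zero (by simp))
    Agf_one_one (fun k m h => Agf_succ h) Pgf_rec Sps_eq
  simp only [Finset.sum_range_succ, Finset.sum_range_zero, zero_add, c13, c13.X]
  linear_combination key
end
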